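/- arXiv:math/0701810 — 6 statements merged into one kernel-verified Lean document; each statement's English description precedes it below -/
import Mathlib

section
/- Let x_1,…,x_n be a sample of symbols of A, 0 < d < n and f(n) > 0. Then for every string w with 0 ≤ ℓ(w) ≤ d and N_n(w) ≥ 1: V_w(x_1^n) = max_{τ ∈ F^d_w(x_1^n)} ∏_{u∈τ} e^{−f(n)} P̂_{ML,u}(x_1^n) = ∏_{u∈τ_w(x_1^n)} e^{−f(n)} P̂_{ML,u}(x_1^n); in particular the maximizing tree τ_w(x_1^n) belongs to F^d_w(x_1^n) and attains the maximum. -/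
open Finset Real

variable {A : Type} [Fintype A] [DecidableEq A]

/-- `N_n(w,a)`: number of occurrences of the symbol `a` preceded by the string `w`
in the sample `x`, counted for `t ∈ {d+1, …, n}`. -/
def Nwa (x : ℕ → A) (n d : ℕ) (w : List A) (a : A) : ℕ :=
  ((Finset.Icc (d + 1) n).filter
    (fun t => (∀ i : Fin w.length, x (t - w.length + i) = w.get i) ∧ x t = a)).card

/-- `N_n(w) = ∑ₐ N_n(w,a)`. -/
def Nw (x : ℕ → A) (n d : ℕ) (w : List A) : ℕ := ∑ a : A, Nwa x n d w a

/-- Empirical conditional probability `p̂_n(a|w) = N_n(w,a)/N_n(w)`. -/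
noncomputable def phat (x : ℕ → A) (n d : ℕ) (w : List A) (a : A) : ℝ :=
  (Nwa x n d w a : ℝ) / (Nw x n d w : ℝ)

/-- Maximum likelihood attached to `w`:
`P̂_{ML,w}(x₁ⁿ) = ∏ₐ p̂_n(a|w) ^ N_n(w,a)` (convention `0⁰ = 1`). -/
noncomputable def Pml (x : ℕ → A) (n d : ℕ) (w : List A) : ℝ :=
  ∏ a : A, phat x n d w a ^ Nwa x n d w a

/-- `s ≺ w` : `s` is a proper suffix of `w`, i.e. `w = u ++ s` with `u` nonempty. -/
def PSuffix (s w : List A) : Prop := s <:+ w ∧ s ≠ w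

/-- `F^d_w(x₁ⁿ)`: the family of nonempty finite suffix-free sets `τ` of strings
extending `w`, of length at most `d`, occurring in the sample, such that every
string `u'` extending `w`, of length at most `d` and occurring in the sample,
belongs to `τ`, is a (proper) suffix of an element of `τ`, or has a (proper)
suffix extending `w` that belongs to `τ`. -/
def Fdw (x : ℕ → A) (n d : ℕ) (w : List A) : Set (Finset (List A)) :=
  {τ | τ.Nonempty ∧
    (∀ u ∈ τ, (w <:+ u) ∧ u.length ≤ d ∧ 1 ≤ Nw x n d u) ∧
    (∀ u ∈ τ, ∀ v ∈ τ, ¬ PSuffix u v) ∧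
    (∀ u' : List A, w <:+ u' → u'.length ≤ d → 1 ≤ Nw x n d u' →
      u' ∈ τ ∨ (∃ u ∈ τ, PSuffix u' u) ∨ ∃ s ∈ τ, w <:+ s ∧ PSuffix s u')}

/-- The value `V_w(x₁ⁿ)` of the context tree maximizing procedure, defined by
backward recursion starting from the strings of length `d`; factors `V_{aw}` with
`N_n(aw) = 0` are taken equal to `1`. -/
noncomputable def V (x : ℕ → A) (n d : ℕ) (f : ℝ) (w : List A) : ℝ :=
  if h : w.length < d then
    max (Real.exp (-f) * Pml x n d w)
      (∏ a : A, if 1 ≤ Nw x n d (a :: w) then V x n d f (a :: w) else 1)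
  else Real.exp (-f) * Pml x n d w
  termination_by d - w.length
  decreasing_by simp only [List.length_cons]; omega

open Classical in
/-- The indicator `χ_w(x₁ⁿ)`: equal to `1` when `N_n(w) ≥ 1`, `ℓ(w) < d` and
`∏ₐ V_{aw}(x₁ⁿ) > e^{-f(n)} P̂_{ML,w}(x₁ⁿ)`, and `0` otherwise. -/
noncomputable def chi (x : ℕ → A) (n d : ℕ) (f : ℝ) (w : List A) : ℕ :=
  if 1 ≤ Nw x n d w ∧ w.length < d ∧
      Real.exp (-f) * Pml x n d w <
        ∏ a : A, (if 1 ≤ Nw x n d (a :: w) then V x n d f (a :: w) else 1)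
  then 1 else 0

/-- The finite set of all strings of length at most `d`. -/
def stringsLe (d : ℕ) : Finset (List A) :=
  (Finset.range (d + 1)).biUnion fun k =>
    (Finset.univ : Finset (Fin k → A)).image fun g => List.ofFn g

open Classical in
/-- The maximizing tree `τ_w(x₁ⁿ)` assigned to the string `w`:
`{u : w ⪯ u, N_n(u) ≥ 1, χ_u = 0 and χ_v = 1 for all v with w ⪯ v ≺ u}` if
`χ_w(x₁ⁿ) = 1`, and `{w}` if `χ_w(x₁ⁿ) = 0`. -/
noncomputable def maxTree (x : ℕ → A) (n d : ℕ) (f : ℝ) (w : List A) :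
    Finset (List A) :=
  if chi x n d f w = 1 then
    (stringsLe (A := A) d).filter fun u =>
      w <:+ u ∧ 1 ≤ Nw x n d u ∧ chi x n d f u = 0 ∧
        ∀ v : List A, w <:+ v → PSuffix v u → chi x n d f v = 1
  else {w}

theorem one_le_Nw_iff {A : Type} [Fintype A] [DecidableEq A] {x : ℕ → A} {n d : ℕ} {w : List A} :
    1 ≤ Nw x n d w ↔
      ∃ t ∈ Finset.Icc (d + 1) n, ∀ i : Fin w.length, x (t - w.length + i) = w.get i := by
  rw [Nw, Nat.one_le_iff_ne_zero, Ne, Finset.sum_eq_zero_iff]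
  push Not
  constructor
  · rintro ⟨a, -, ha⟩
    obtain ⟨t, ht⟩ := Finset.card_pos.mp (Nat.pos_of_ne_zero ha)
    rw [Finset.mem_filter] at ht
    exact ⟨t, ht.1, ht.2.1⟩
  · rintro ⟨t, ht, hw⟩
    exact ⟨x t, Finset.mem_univ _,
      (Finset.card_pos.mpr ⟨t, Finset.mem_filter.mpr ⟨ht, hw, rfl⟩⟩).ne'⟩

theorem one_le_Nw_of_cons {A : Type} [Fintype A] [DecidableEq A] {x : ℕ → A} {n d : ℕ}
    {w : List A} {a : A} (hw : w.length < d) (h : 1 ≤ Nw x n d (a :: w)) : 1 ≤ Nw x n d w := by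
  rw [one_le_Nw_iff] at h ⊢
  obtain ⟨t, ht, h⟩ := h
  refine ⟨t, ht, fun i => ?_⟩
  have hi := h i.succ
  rw [Finset.mem_Icc] at ht
  have e : t - (a :: w).length + (i.succ : Fin (w.length + 1)) = t - w.length + i := by
    simp only [List.length_cons, Fin.val_succ]
    omega
  rw [e] at hi
  simpa using hi

theorem one_le_Nw_of_suffix {A : Type} [Fintype A] [DecidableEq A] {x : ℕ → A} {n d : ℕ}
    {w u : List A} (hwu : w <:+ u) (hu : u.length ≤ d) (h : 1 ≤ Nw x n d u) :
    1 ≤ Nw x n d w := by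
  induction u with
  | nil => rwa [List.suffix_nil.mp hwu]
  | cons b u ih =>
    rcases List.suffix_cons_iff.mp hwu with rfl | hs
    · exact h
    · rw [List.length_cons] at hu
      exact ih hs (by omega) (one_le_Nw_of_cons (by omega) h)

theorem exists_one_le_Nw_cons {A : Type} [Fintype A] [DecidableEq A] {x : ℕ → A} {n d : ℕ}
    {w : List A} (hw : w.length < d) (h : 1 ≤ Nw x n d w) : ∃ a, 1 ≤ Nw x n d (a :: w) := by
  obtain ⟨t, ht, h⟩ := one_le_Nw_iff.mp h
  refine ⟨x (t - (w.length + 1)), one_le_Nw_iff.mpr ⟨t, ht, fun i => ?_⟩⟩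
  rw [Finset.mem_Icc] at ht
  change Fin (w.length + 1) at i
  refine Fin.cases ?_ (fun j => ?_) i
  · simp
  · have e : t - (x (t - (w.length + 1)) :: w).length + (j.succ : Fin (w.length + 1))
        = t - w.length + j := by
      simp only [List.length_cons, Fin.val_succ]
      omega
    rw [e, h j]
    simp

theorem suffix_iff_eq_or_cons {A : Type} {w u : List A} :
    w <:+ u ↔ u = w ∨ ∃ a, (a :: w) <:+ u := by
  constructor
  · rintro ⟨s, rfl⟩
    rcases List.eq_nil_or_concat s with rfl | ⟨s, a, rfl⟩
    · exact Or.inl rfl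
    · exact Or.inr ⟨a, s, by simp⟩
  · rintro (rfl | ⟨a, h⟩)
    · exact List.suffix_refl _
    · exact (List.suffix_cons a w).trans h

theorem cons_suffix_unique {A : Type} {w u : List A} {a b : A}
    (ha : (a :: w) <:+ u) (hb : (b :: w) <:+ u) : a = b := by
  have h := List.suffix_of_suffix_length_le ha hb (by simp)
  have := h.eq_of_length (by simp)
  simp_all

theorem not_cons_suffix_self {A : Type} {w : List A} {a : A} : ¬ (a :: w) <:+ w := fun h => by
  have := h.length_le
  simp at this

/-- The symbols extending `w` to the left to a string occurring in the sample. -/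
def children {A : Type} [Fintype A] [DecidableEq A] (x : ℕ → A) (n d : ℕ) (w : List A) :
    Finset A :=
  Finset.univ.filter fun a => 1 ≤ Nw x n d (a :: w)

theorem mem_children {A : Type} [Fintype A] [DecidableEq A] {x : ℕ → A} {n d : ℕ} {w : List A}
    {a : A} : a ∈ children x n d w ↔ 1 ≤ Nw x n d (a :: w) := by
  simp [children]

theorem prod_children {A : Type} [Fintype A] [DecidableEq A] (x : ℕ → A) (n d : ℕ) (w : List A)
    (g : A → ℝ) :
    (∏ a : A, if 1 ≤ Nw x n d (a :: w) then g a else 1) = ∏ a ∈ children x n d w, g a := by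
  rw [children, Finset.prod_filter]

theorem prod_biUnion_of_cons_suffix {A : Type} [DecidableEq A] {w : List A} (C : Finset A)
    (T : A → Finset (List A)) (hT : ∀ a ∈ C, ∀ u ∈ T a, (a :: w) <:+ u) (g : List A → ℝ) :
    ∏ u ∈ C.biUnion T, g u = ∏ a ∈ C, ∏ u ∈ T a, g u := by
  refine Finset.prod_biUnion fun a ha b hb hab => Finset.disjoint_left.mpr fun u hu hu' => hab ?_
  exact cons_suffix_unique (hT a ha u hu) (hT b hb u hu')

theorem singleton_mem_Fdw {A : Type} [Fintype A] [DecidableEq A] {x : ℕ → A} {n d : ℕ}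
    {w : List A} (hw : w.length ≤ d) (h : 1 ≤ Nw x n d w) : {w} ∈ Fdw x n d w := by
  refine ⟨Finset.singleton_nonempty w, ?_, ?_, ?_⟩
  · intro u hu
    rw [Finset.mem_singleton.mp hu]
    exact ⟨List.suffix_refl w, hw, h⟩
  · intro u hu v hv huv
    exact huv.2 ((Finset.mem_singleton.mp hu).trans (Finset.mem_singleton.mp hv).symm)
  · intro u hwu _ _
    by_cases e : u = w
    · exact Or.inl (Finset.mem_singleton.mpr e)
    · exact Or.inr (Or.inr ⟨w, Finset.mem_singleton_self w, List.suffix_refl w, hwu, Ne.symm e⟩)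

theorem biUnion_mem_Fdw {A : Type} [Fintype A] [DecidableEq A] {x : ℕ → A} {n d : ℕ}
    {w : List A} (hw : w.length < d) (h : 1 ≤ Nw x n d w) (T : A → Finset (List A))
    (hT : ∀ a ∈ children x n d w, T a ∈ Fdw x n d (a :: w)) :
    (children x n d w).biUnion T ∈ Fdw x n d w := by
  obtain ⟨b, hb⟩ := exists_one_le_Nw_cons hw h
  rw [← mem_children] at hb
  obtain ⟨z, hz⟩ := (hT b hb).1
  have hz' := Finset.mem_biUnion.mpr ⟨b, hb, hz⟩
  refine ⟨⟨z, hz'⟩, ?_, ?_, ?_⟩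
  · intro u hu
    obtain ⟨a, ha, hu⟩ := Finset.mem_biUnion.mp hu
    obtain ⟨h1, h2⟩ := (hT a ha).2.1 u hu
    exact ⟨(List.suffix_cons a w).trans h1, h2⟩
  · intro u hu v hv huv
    obtain ⟨a, ha, hu⟩ := Finset.mem_biUnion.mp hu
    obtain ⟨c, hc, hv⟩ := Finset.mem_biUnion.mp hv
    obtain rfl : a = c := cons_suffix_unique (((hT a ha).2.1 u hu).1.trans huv.1)
      ((hT c hc).2.1 v hv).1
    exact (hT a ha).2.2.1 u hu v hv huv
  · intro u hwu hud hNu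
    rcases suffix_iff_eq_or_cons.mp hwu with rfl | ⟨a, hau⟩
    · have hbz := ((hT b hb).2.1 z hz).1
      refine Or.inr (Or.inl ⟨z, hz', (List.suffix_cons b u).trans hbz, ?_⟩)
      rintro rfl
      exact not_cons_suffix_self hbz
    · have ha := mem_children.mpr (one_le_Nw_of_suffix hau hud hNu)
      rcases (hT a ha).2.2.2 u hau hud hNu with h1 | ⟨v, hv, huv⟩ | ⟨s, hs, has, hsu⟩
      · exact Or.inl (Finset.mem_biUnion.mpr ⟨a, ha, h1⟩)
      · exact Or.inr (Or.inl ⟨v, Finset.mem_biUnion.mpr ⟨a, ha, hv⟩, huv⟩)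
      · exact Or.inr (Or.inr ⟨s, Finset.mem_biUnion.mpr ⟨a, ha, hs⟩,
          (List.suffix_cons a w).trans has, hsu⟩)

theorem eq_singleton_of_mem_Fdw {A : Type} [Fintype A] [DecidableEq A] {x : ℕ → A} {n d : ℕ}
    {w : List A} {τ : Finset (List A)} (hτ : τ ∈ Fdw x n d w) (hw : w ∈ τ) : τ = {w} := by
  refine Finset.eq_singleton_iff_unique_mem.mpr ⟨hw, fun u hu => ?_⟩
  by_contra e
  exact hτ.2.2.1 w hw u hu ⟨(hτ.2.1 u hu).1, Ne.symm e⟩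

/-- The elements of `τ` extending `w`. -/
def extending {A : Type} [DecidableEq A] (τ : Finset (List A)) (w : List A) : Finset (List A) :=
  τ.filter fun u => w <:+ u

theorem extending_cons_mem_Fdw {A : Type} [Fintype A] [DecidableEq A] {x : ℕ → A} {n d : ℕ}
    {w : List A} {τ : Finset (List A)} (hτ : τ ∈ Fdw x n d w) (hwτ : w ∉ τ)
    (hw : w.length < d) {a : A} (ha : a ∈ children x n d w) :
    extending τ (a :: w) ∈ Fdw x n d (a :: w) := by
  obtain ⟨-, h1, h2, h3⟩ := hτ
  have hcov : ∀ u : List A, (a :: w) <:+ u → u.length ≤ d → 1 ≤ Nw x n d u →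
      u ∈ τ ∨ (∃ v ∈ τ, PSuffix u v) ∨ ∃ s ∈ τ, (a :: w) <:+ s ∧ PSuffix s u := by
    intro u hau hud hNu
    rcases h3 u ((List.suffix_cons a w).trans hau) hud hNu with h | h | ⟨s, hs, hws, hsu⟩
    · exact Or.inl h
    · exact Or.inr (Or.inl h)
    · rcases suffix_iff_eq_or_cons.mp hws with rfl | ⟨b, hb⟩
      · exact absurd hs hwτ
      · obtain rfl := cons_suffix_unique (hb.trans hsu.1) hau
        exact Or.inr (Or.inr ⟨s, hs, hb, hsu⟩)
  refine ⟨?_, ?_, ?_, ?_⟩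
  · rcases hcov (a :: w) (List.suffix_refl _) hw (mem_children.mp ha) with
      h | ⟨v, hv, hav⟩ | ⟨s, hs, has, -⟩
    · exact ⟨_, Finset.mem_filter.mpr ⟨h, List.suffix_refl _⟩⟩
    · exact ⟨v, Finset.mem_filter.mpr ⟨hv, hav.1⟩⟩
    · exact ⟨s, Finset.mem_filter.mpr ⟨hs, has⟩⟩
  · intro u hu
    obtain ⟨hu, hau⟩ := Finset.mem_filter.mp hu
    exact ⟨hau, (h1 u hu).2⟩
  · intro u hu v hv
    exact h2 u (Finset.mem_filter.mp hu).1 v (Finset.mem_filter.mp hv).1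
  · intro u hau hud hNu
    rcases hcov u hau hud hNu with h | ⟨v, hv, huv⟩ | ⟨s, hs, has, hsu⟩
    · exact Or.inl (Finset.mem_filter.mpr ⟨h, hau⟩)
    · exact Or.inr (Or.inl ⟨v, Finset.mem_filter.mpr ⟨hv, hau.trans huv.1⟩, huv⟩)
    · exact Or.inr (Or.inr ⟨s, Finset.mem_filter.mpr ⟨hs, has⟩, has, hsu⟩)

theorem biUnion_extending_cons {A : Type} [Fintype A] [DecidableEq A] {x : ℕ → A} {n d : ℕ}
    {w : List A} {τ : Finset (List A)} (hτ : τ ∈ Fdw x n d w) (hwτ : w ∉ τ) :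
    (children x n d w).biUnion (fun a => extending τ (a :: w)) = τ := by
  ext u
  simp only [Finset.mem_biUnion, extending, Finset.mem_filter, mem_children]
  constructor
  · rintro ⟨_, -, h, -⟩
    exact h
  · intro hu
    obtain ⟨hwu, hud, hNu⟩ := hτ.2.1 u hu
    rcases suffix_iff_eq_or_cons.mp hwu with rfl | ⟨a, hau⟩
    · exact absurd hu hwτ
    · exact ⟨a, one_le_Nw_of_suffix hau hud hNu, hu, hau⟩

theorem length_lt_of_mem_Fdw {A : Type} [Fintype A] [DecidableEq A] {x : ℕ → A} {n d : ℕ}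
    {w : List A} {τ : Finset (List A)} (hτ : τ ∈ Fdw x n d w) (hwτ : w ∉ τ) : w.length < d := by
  obtain ⟨u, hu⟩ := hτ.1
  obtain ⟨hwu, hud, -⟩ := hτ.2.1 u hu
  rcases suffix_iff_eq_or_cons.mp hwu with rfl | ⟨a, hau⟩
  · exact absurd hu hwτ
  · exact hau.length_le.trans hud

theorem mem_stringsLe {A : Type} [Fintype A] [DecidableEq A] {d : ℕ} {u : List A} :
    u ∈ stringsLe d ↔ u.length ≤ d := by
  simp only [stringsLe, Finset.mem_biUnion, Finset.mem_range, Finset.mem_image, Finset.mem_univ,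
    true_and]
  constructor
  · rintro ⟨k, hk, g, rfl⟩
    rw [List.length_ofFn]
    omega
  · intro h
    exact ⟨u.length, by omega, u.get, List.ofFn_get u⟩

theorem chi_eq_zero_or_one {A : Type} [Fintype A] [DecidableEq A] (x : ℕ → A) (n d : ℕ) (f : ℝ)
    (w : List A) : chi x n d f w = 0 ∨ chi x n d f w = 1 := by
  unfold chi
  split_ifs <;> simp

theorem chi_eq_one_iff {A : Type} [Fintype A] [DecidableEq A] {x : ℕ → A} {n d : ℕ} {f : ℝ}
    {w : List A} :
    chi x n d f w = 1 ↔ 1 ≤ Nw x n d w ∧ w.length < d ∧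
      Real.exp (-f) * Pml x n d w < ∏ a ∈ children x n d w, V x n d f (a :: w) := by
  rw [← prod_children, chi]
  split_ifs with h
  · exact iff_of_true rfl h
  · exact iff_of_false id h

theorem V_of_length_lt {A : Type} [Fintype A] [DecidableEq A] {x : ℕ → A} {n d : ℕ} {f : ℝ}
    {w : List A} (hw : w.length < d) :
    V x n d f w = max (Real.exp (-f) * Pml x n d w)
      (∏ a ∈ children x n d w, V x n d f (a :: w)) := by
  rw [V, dif_pos hw, prod_children]

theorem V_of_chi_eq_zero {A : Type} [Fintype A] [DecidableEq A] {x : ℕ → A} {n d : ℕ} {f : ℝ}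
    {w : List A} (h : 1 ≤ Nw x n d w) (hc : chi x n d f w = 0) :
    V x n d f w = Real.exp (-f) * Pml x n d w := by
  by_cases hw : w.length < d
  · rw [V_of_length_lt hw, max_eq_left]
    by_contra hlt
    rw [chi_eq_one_iff.mpr ⟨h, hw, not_le.mp hlt⟩] at hc
    exact one_ne_zero hc
  · rw [V, dif_neg hw]

theorem mul_Pml_le_V {A : Type} [Fintype A] [DecidableEq A] (x : ℕ → A) (n d : ℕ) (f : ℝ)
    (w : List A) : Real.exp (-f) * Pml x n d w ≤ V x n d f w := by
  by_cases hw : w.length < d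
  · rw [V_of_length_lt hw]
    exact le_max_left _ _
  · rw [V, dif_neg hw]

theorem Pml_nonneg {A : Type} [Fintype A] [DecidableEq A] (x : ℕ → A) (n d : ℕ)
    (w : List A) : 0 ≤ Pml x n d w := by
  unfold Pml phat
  positivity

theorem maxTree_of_chi_eq_zero {A : Type} [Fintype A] [DecidableEq A] {x : ℕ → A} {n d : ℕ}
    {f : ℝ} {w : List A} (hc : chi x n d f w = 0) : maxTree x n d f w = {w} := by
  rw [maxTree, if_neg (by rw [hc]; exact zero_ne_one)]

theorem mem_maxTree {A : Type} [Fintype A] [DecidableEq A] {x : ℕ → A} {n d : ℕ} {f : ℝ}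
    {w u : List A} (hw : w.length ≤ d) (h : 1 ≤ Nw x n d w) :
    u ∈ maxTree x n d f w ↔ u.length ≤ d ∧ w <:+ u ∧ 1 ≤ Nw x n d u ∧ chi x n d f u = 0 ∧
      ∀ v : List A, w <:+ v → PSuffix v u → chi x n d f v = 1 := by
  rcases chi_eq_zero_or_one x n d f w with hc | hc
  · rw [maxTree_of_chi_eq_zero hc, Finset.mem_singleton]
    constructor
    · rintro rfl
      refine ⟨hw, List.suffix_refl u, h, hc, fun v hv hvu => ?_⟩
      exact absurd (hvu.1.eq_of_length_le hv.length_le) hvu.2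
    · rintro ⟨-, hwu, -, -, hv⟩
      by_contra e
      have := hv w (List.suffix_refl w) ⟨hwu, Ne.symm e⟩
      omega
  · simp only [maxTree, if_pos hc, Finset.mem_filter, mem_stringsLe]

theorem maxTree_eq_biUnion {A : Type} [Fintype A] [DecidableEq A] {x : ℕ → A} {n d : ℕ} {f : ℝ}
    {w : List A} (hc : chi x n d f w = 1) :
    maxTree x n d f w = (children x n d w).biUnion fun a => maxTree x n d f (a :: w) := by
  obtain ⟨h, hw, -⟩ := chi_eq_one_iff.mp hc
  ext u
  rw [mem_maxTree hw.le h, Finset.mem_biUnion]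
  constructor
  · rintro ⟨hud, hwu, hNu, hcu, hv⟩
    rcases suffix_iff_eq_or_cons.mp hwu with rfl | ⟨a, hau⟩
    · omega
    · have ha := one_le_Nw_of_suffix hau hud hNu
      exact ⟨a, mem_children.mpr ha, (mem_maxTree hw ha).mpr
        ⟨hud, hau, hNu, hcu, fun v hav => hv v ((List.suffix_cons a w).trans hav)⟩⟩
  · rintro ⟨a, ha, hu⟩
    obtain ⟨hud, hau, hNu, hcu, hv⟩ := (mem_maxTree hw (mem_children.mp ha)).mp hu
    refine ⟨hud, (List.suffix_cons a w).trans hau, hNu, hcu, fun v hwv hvu => ?_⟩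
    rcases suffix_iff_eq_or_cons.mp hwv with rfl | ⟨b, hbv⟩
    · exact hc
    · obtain rfl := cons_suffix_unique (hbv.trans hvu.1) hau
      exact hv v hbv hvu

theorem maxTree_mem_Fdw_and_V_eq_prod {A : Type} [Fintype A] [DecidableEq A] {x : ℕ → A}
    {n d : ℕ} {f : ℝ} (w : List A) (hw : w.length ≤ d) (h : 1 ≤ Nw x n d w) :
    maxTree x n d f w ∈ Fdw x n d w ∧
      V x n d f w = ∏ u ∈ maxTree x n d f w, Real.exp (-f) * Pml x n d u := by
  rcases chi_eq_zero_or_one x n d f w with hc | hc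
  · rw [maxTree_of_chi_eq_zero hc, Finset.prod_singleton]
    exact ⟨singleton_mem_Fdw hw h, V_of_chi_eq_zero h hc⟩
  · obtain ⟨-, hlt, hV⟩ := chi_eq_one_iff.mp hc
    have ih : ∀ a ∈ children x n d w, maxTree x n d f (a :: w) ∈ Fdw x n d (a :: w) ∧
        V x n d f (a :: w) = ∏ u ∈ maxTree x n d f (a :: w), Real.exp (-f) * Pml x n d u :=
      fun a ha => maxTree_mem_Fdw_and_V_eq_prod (a :: w) hlt (mem_children.mp ha)
    rw [maxTree_eq_biUnion hc]
    refine ⟨biUnion_mem_Fdw hlt h _ fun a ha => (ih a ha).1, ?_⟩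
    rw [prod_biUnion_of_cons_suffix _ _ fun a ha u hu => ((ih a ha).1.2.1 u hu).1,
      V_of_length_lt hlt, max_eq_right hV.le]
    exact Finset.prod_congr rfl fun a ha => (ih a ha).2
termination_by d - w.length
decreasing_by simp only [List.length_cons]; omega

theorem prod_le_V_of_mem_Fdw {A : Type} [Fintype A] [DecidableEq A] {x : ℕ → A} {n d : ℕ}
    {f : ℝ} (w : List A) {τ : Finset (List A)} (hτ : τ ∈ Fdw x n d w) :
    ∏ u ∈ τ, Real.exp (-f) * Pml x n d u ≤ V x n d f w := by
  by_cases hwτ : w ∈ τ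
  · rw [eq_singleton_of_mem_Fdw hτ hwτ, Finset.prod_singleton]
    exact mul_Pml_le_V x n d f w
  · have hlt := length_lt_of_mem_Fdw hτ hwτ
    rw [← biUnion_extending_cons hτ hwτ, V_of_length_lt hlt,
      prod_biUnion_of_cons_suffix _ (fun a => extending τ (a :: w))
        fun a _ u hu => (Finset.mem_filter.mp hu).2]
    refine le_max_of_le_right (Finset.prod_le_prod (fun a _ => ?_) fun a ha => ?_)
    · exact Finset.prod_nonneg fun u _ => mul_nonneg (Real.exp_pos _).le (Pml_nonneg x n d u)
    · exact prod_le_V_of_mem_Fdw (a :: w) (extending_cons_mem_Fdw hτ hwτ hlt ha)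
termination_by d - w.length
decreasing_by simp only [List.length_cons]; omega

/-- **Lemma (Csiszár–Talata): the context tree maximizing principle at a node.**
For `0 < d < n`, a penalizing value `f(n) > 0` and any string `w` with
`0 ≤ ℓ(w) ≤ d` and `N_n(w) ≥ 1`, the value `V_w(x₁ⁿ)` equals the maximum of
`∏_{u∈τ} e^{-f(n)} P̂_{ML,u}(x₁ⁿ)` over `τ ∈ F^d_w(x₁ⁿ)`, and the maximum is
attained by the maximizing tree `τ_w(x₁ⁿ)`, which belongs to `F^d_w(x₁ⁿ)`. -/
theorem V_eq_max_over_Fdw {A : Type} [Fintype A] [DecidableEq A]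
    (hA : 1 < Fintype.card A)
    (x : ℕ → A) (n d : ℕ) (hd : 0 < d) (hdn : d < n) (f : ℝ) (hf : 0 < f)
    (w : List A) (hwd : w.length ≤ d) (hNw : 1 ≤ Nw x n d w) :
    maxTree x n d f w ∈ Fdw x n d w ∧
    V x n d f w = ∏ u ∈ maxTree x n d f w, Real.exp (-f) * Pml x n d u ∧
    ∀ τ ∈ Fdw x n d w,
      (∏ u ∈ τ, Real.exp (-f) * Pml x n d u) ≤ V x n d f w := by
  obtain ⟨h1, h2⟩ := maxTree_mem_Fdw_and_V_eq_prod (f := f) w hwd hNw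
  exact ⟨h1, h2, fun τ hτ => prod_le_V_of_mem_Fdw w hτ⟩
end

section
/- Under the concentration hypothesis with constant C > 0, for every string w with 0 ≤ ℓ(w) ≤ d and p(w) > 0, every a ∈ A and every t > 0: P( {N_n(w) ≥ 1} ∩ { |p̂_n(a|w) − p(a|w)| > t } ) ≤ 2 e^{1/e} |A| exp( −(n−d) t² p(w)² C / (4 |A|² (ℓ(w)+1)) ). -/
open Finset Real MeasureTheory

variable {A : Type} [Fintype A] [DecidableEq A]

/-- Deterministic comparison of the ratio of a count to the total count with the ratio of the
expected values, when every count is within `s` of its expected value. -/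
lemma abs_div_sum_sub_div_sum_le {ι : Type*} [Fintype ι] (N q : ι → ℝ) (hN : ∀ b, 0 ≤ N b)
    {M s : ℝ} (hM : 0 < M) (hq : 0 < ∑ b, q b) (hpos : 0 < ∑ b, N b)
    (h : ∀ b, |N b - M * q b| ≤ s) (a : ι) :
    |N a / (∑ b, N b) - q a / ∑ b, q b| ≤ (1 + Fintype.card ι) * s / (M * ∑ b, q b) := by
  have hsum : |∑ b, N b - M * ∑ b, q b| ≤ Fintype.card ι * s := by
    rw [Finset.mul_sum, ← Finset.sum_sub_distrib]
    refine (Finset.abs_sum_le_sum_abs _ _).trans ((Finset.sum_le_sum fun b _ => h b).trans ?_)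
    simp
  have hle : N a ≤ ∑ b, N b := Finset.single_le_sum (fun b _ => hN b) (Finset.mem_univ a)
  have ha := h a
  have haN := hN a
  generalize (∑ b, N b) = S at *
  generalize (∑ b, q b) = Q at *
  have hratio : N a / S ≤ 1 := (div_le_one hpos).2 hle
  have hratio0 : 0 ≤ N a / S := div_nonneg haN hpos.le
  have key : N a / S - q a / Q = ((N a - M * q a) - N a / S * (S - M * Q)) / (M * Q) := by
    field_simp
    ring
  rw [key, abs_div, abs_of_pos (mul_pos hM hq)]
  gcongr
  calc |N a - M * q a - N a / S * (S - M * Q)|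
      ≤ |N a - M * q a| + |N a / S * (S - M * Q)| := abs_sub _ _
    _ ≤ s + 1 * (Fintype.card ι * s) := by
        rw [abs_mul, abs_of_nonneg hratio0]
        gcongr
    _ = (1 + Fintype.card ι) * s := by ring

/-- **Deviation bound for the empirical conditional probabilities (Corollary, part (a)).**
Under the concentration hypothesis with constant `C > 0`, for every string `w` with
`ℓ(w) ≤ d` and `p(w) > 0`, every `a ∈ A` and `t > 0`,
`P({N_n(w) ≥ 1} ∩ {|p̂_n(a|w) - p(a|w)| > t})` is at most
`2 e^{1/e} |A| exp(-(n-d) t² p(w)² C / (4|A|² (ℓ(w)+1)))`. -/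
theorem phat_deviation_bound {A : Type} [Fintype A] [DecidableEq A]
    [MeasurableSpace A] (hA : 1 < Fintype.card A)
    {Ω : Type} [MeasurableSpace Ω] (P : Measure Ω) [IsProbabilityMeasure P]
    (n d : ℕ) (hd : 0 < d) (hdn : d < n)
    (X : ℕ → Ω → A) (hX : ∀ t, Measurable (X t))
    (p : List A → ℝ) (hp01 : ∀ u, 0 ≤ p u ∧ p u ≤ 1) (hpnil : p ([] : List A) = 1)
    (hpsum : ∀ u, p u = ∑ b : A, p (u ++ [b]))
    (C : ℝ) (hC : 0 < C)
    (hconc : ∀ u : List A, u.length ≤ d → ∀ a : A, ∀ t : ℝ, 0 < t →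
      P {ω | t < |(Nwa (fun s => X s ω) n d u a : ℝ) - ((n : ℝ) - d) * p (u ++ [a])|} ≤
        ENNReal.ofReal (Real.exp (1 / Real.exp 1) *
          Real.exp (-(t ^ 2 * C / (((n : ℝ) - d) * (u.length + 1))))))
    (w : List A) (hwd : w.length ≤ d) (hpw : 0 < p w) (a : A) (t : ℝ) (ht : 0 < t) :
    P {ω | 1 ≤ Nw (fun s => X s ω) n d w ∧
        t < |phat (fun s => X s ω) n d w a - p (w ++ [a]) / p w|} ≤
      ENNReal.ofReal (2 * Real.exp (1 / Real.exp 1) * (Fintype.card A : ℝ) *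
        Real.exp (-(((n : ℝ) - d) * t ^ 2 * p w ^ 2 * C /
          (4 * (Fintype.card A : ℝ) ^ 2 * (w.length + 1))))) := by
  have hM : (0 : ℝ) < (n : ℝ) - d := sub_pos.2 (by exact_mod_cast hdn)
  have hk : (1 : ℝ) < Fintype.card A := by exact_mod_cast hA
  set M : ℝ := (n : ℝ) - d
  set k : ℝ := (Fintype.card A : ℝ)
  have hk0 : 0 < k := one_pos.trans hk
  set s : ℝ := M * p w * t / (2 * k) with hs
  have hs0 : 0 < s := by positivity
  have hsub : {ω | 1 ≤ Nw (fun s => X s ω) n d w ∧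
        t < |phat (fun s => X s ω) n d w a - p (w ++ [a]) / p w|} ⊆
      ⋃ b : A, {ω | s < |(Nwa (fun s => X s ω) n d w b : ℝ) - M * p (w ++ [b])|} := by
    rintro ω ⟨hNw, hdev⟩
    by_contra hω
    simp only [Set.mem_iUnion, Set.mem_ofPred_eq, not_exists, not_lt] at hω
    have hcast : (Nw (fun s => X s ω) n d w : ℝ) =
        ∑ b, (Nwa (fun s => X s ω) n d w b : ℝ) := by
      simp [Nw]
    have hpos : (0 : ℝ) < ∑ b, (Nwa (fun s => X s ω) n d w b : ℝ) := by
      rw [← hcast]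
      exact_mod_cast hNw
    have hbound := abs_div_sum_sub_div_sum_le
      (fun b => (Nwa (fun s => X s ω) n d w b : ℝ)) (fun b => p (w ++ [b]))
      (fun b => Nat.cast_nonneg _) hM (hpsum w ▸ hpw) hpos hω a
    rw [← hpsum w, ← hcast] at hbound
    have hle : (1 + k) * s / (M * p w) ≤ t := by
      have : (1 + k) * s / (M * p w) = t * ((1 + k) / (2 * k)) := by
        rw [hs]
        field_simp
      rw [this]
      exact mul_le_of_le_one_right ht.le ((div_le_one (by positivity)).2 (by linarith))
    exact (hdev.trans_le (hbound.trans hle)).false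
  refine (measure_mono hsub).trans ((measure_iUnion_fintype_le P _).trans
    ((Finset.sum_le_sum fun b _ => hconc w hwd b s hs0).trans ?_))
  rw [Finset.sum_const, ← ENNReal.ofReal_nsmul, Finset.card_univ, nsmul_eq_mul]
  apply ENNReal.ofReal_le_ofReal
  have hexp : s ^ 2 * C / (M * (w.length + 1)) =
      M * t ^ 2 * p w ^ 2 * C / (4 * k ^ 2 * (w.length + 1)) := by
    rw [hs]
    field_simp
    ring
  rw [hexp]
  set E := Real.exp (-(M * t ^ 2 * p w ^ 2 * C / (4 * k ^ 2 * (w.length + 1))))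
  have hprod : 0 ≤ k * (Real.exp (1 / Real.exp 1) * E) := by positivity
  calc k * (Real.exp (1 / Real.exp 1) * E)
      ≤ 2 * (k * (Real.exp (1 / Real.exp 1) * E)) := by linarith
    _ = 2 * Real.exp (1 / Real.exp 1) * k * E := by ring
end

section
/- Under the concentration hypothesis with constant C > 0, let w be a string with 0 ≤ ℓ(w) ≤ d and p(w) > 0, and suppose there is α₀ ∈ (0,1) with p(a|w) ≥ α₀ for every a ∈ A. Define L_n(w) = ∑_{a∈A} [ p(wa) log p(a|w) − (N_n(w,a)/(n−d)) log p̂_n(a|w) ] (with 0·log 0 = 0). Then for every t > 0: P( {N_n(w) ≥ 1} ∩ { |L_n(w)| > t } ) ≤ 3 e^{1/e} |A|² exp( −(n−d) min(t, t²) p(w)² C α₀ / (8 |A|³ max(1, (log α₀)²) (ℓ(w)+1)) ). -/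
/-- The lower bound `x - y ≤ x log (x / y)`, split into a difference of logarithms. -/
theorem sub_le_mul_log_sub_mul_log {x y : ℝ} (hx : 0 ≤ x) (hy : 0 < y) :
    x - y ≤ x * Real.log x - x * Real.log y := by
  rcases hx.eq_or_lt with rfl | hx
  · simp [hy.le]
  · have h := Real.log_le_sub_one_of_pos (div_pos hy hx)
    rw [Real.log_div hy.ne' hx.ne'] at h
    have h' := mul_le_mul_of_nonneg_left h hx.le
    have e : x * (y / x - 1) = y - x := by field_simp
    linarith

/-- The quadratic upper bound `x log (x / y) ≤ x - y + (x - y) ^ 2 / y`, split into a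
difference of logarithms. -/
theorem mul_log_sub_mul_log_le {x y : ℝ} (hx : 0 ≤ x) (hy : 0 < y) :
    x * Real.log x - x * Real.log y ≤ x - y + (x - y) ^ 2 / y := by
  rcases hx.eq_or_lt with rfl | hx
  · have e : (0 - y) ^ 2 / y = y := by field_simp; ring
    rw [e]; simp
  · have h := Real.log_le_sub_one_of_pos (div_pos hx hy)
    rw [Real.log_div hx.ne' hy.ne'] at h
    have h' := mul_le_mul_of_nonneg_left h hx.le
    have e : x * (x / y - 1) = x - y + (x - y) ^ 2 / y := by field_simp; ring
    linarith

/-- Stability of the (unnormalised) log-likelihood `∑ r log (r / ∑ r)` under a uniformly small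
perturbation of a weight vector `r` whose normalisation is bounded below by `α`. -/
theorem abs_sum_mul_log_sub_le {ι : Type*} [Fintype ι] {q r : ι → ℝ} {Q R α s : ℝ}
    (hq : ∀ a, 0 ≤ q a) (hQ : Q = ∑ a, q a) (hQ0 : 0 < Q) (hR : R = ∑ a, r a) (hR0 : 0 < R)
    (hα : 0 < α) (hr : ∀ a, α ≤ r a / R) (hs : ∀ a, |q a - r a| ≤ s) :
    |∑ a, (r a * Real.log (r a / R) - q a * Real.log (q a / Q))| ≤
      Fintype.card ι * (s * |Real.log α| + s ^ 2 / (R * α)) := by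
  have hαr a : R * α ≤ r a := by
    have := (le_div_iff₀ hR0).1 (hr a)
    linarith
  have hr0 a : 0 < r a := (mul_pos hR0 hα).trans_le (hαr a)
  have hrR a : r a / R ≤ 1 := by
    rw [div_le_one hR0, hR]
    exact Finset.single_le_sum (fun b _ => (hr0 b).le) (Finset.mem_univ a)
  have hlog a : |Real.log (r a / R)| ≤ |Real.log α| := by
    have h1 := Real.log_le_log hα (hr a)
    have h2 := Real.log_nonpos (hα.le.trans (hr a)) (hrR a)
    rw [abs_of_nonpos h2, abs_of_nonpos (h1.trans h2)]
    linarith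
  have hqlog a : q a * Real.log (q a / Q) = q a * Real.log (q a) - q a * Real.log Q := by
    rcases (hq a).eq_or_lt with h | h
    · simp [← h]
    · rw [Real.log_div h.ne' hQ0.ne']; ring
  have hrlog a : Real.log (r a / R) = Real.log (r a) - Real.log R :=
    Real.log_div (hr0 a).ne' hR0.ne'
  have hD0 : 0 ≤ ∑ a, (q a * Real.log (q a / Q) - q a * Real.log (r a / R)) := by
    have h : ∑ a, (q a - Q * r a / R) ≤
        ∑ a, (q a * Real.log (q a / Q) - q a * Real.log (r a / R)) := by
      refine Finset.sum_le_sum fun a _ => ?_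
      have h := sub_le_mul_log_sub_mul_log (hq a) (div_pos (mul_pos hQ0 (hr0 a)) hR0)
      rw [Real.log_div (mul_pos hQ0 (hr0 a)).ne' hR0.ne',
        Real.log_mul hQ0.ne' (hr0 a).ne'] at h
      rw [hqlog, hrlog]
      linarith
    refine le_trans (le_of_eq ?_) h
    rw [Finset.sum_sub_distrib, ← Finset.sum_div, ← Finset.mul_sum, ← hQ, ← hR,
      mul_div_cancel_right₀ _ hR0.ne', sub_self]
  have hD1 : ∑ a, (q a * Real.log (q a / Q) - q a * Real.log (r a / R)) ≤
      Fintype.card ι * (s ^ 2 / (R * α)) := by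
    have h : ∑ a, (q a * Real.log (q a / Q) - q a * Real.log (r a / R)) ≤
        ∑ a, (q a - r a + s ^ 2 / (R * α) - q a * (Real.log Q - Real.log R)) := by
      refine Finset.sum_le_sum fun a _ => ?_
      have h := mul_log_sub_mul_log_le (hq a) (hr0 a)
      have h2 : (q a - r a) ^ 2 / r a ≤ s ^ 2 / (R * α) :=
        div_le_div₀ (sq_nonneg s) (sq_le_sq' (abs_le.1 (hs a)).1 (abs_le.1 (hs a)).2)
          (mul_pos hR0 hα) (hαr a)
      rw [hqlog, hrlog]
      linarith
    have e : ∑ a, (q a - r a + s ^ 2 / (R * α) - q a * (Real.log Q - Real.log R)) =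
        Q - R + Fintype.card ι * (s ^ 2 / (R * α)) - Q * (Real.log Q - Real.log R) := by
      rw [Finset.sum_sub_distrib, Finset.sum_add_distrib, Finset.sum_sub_distrib,
        ← Finset.sum_mul, ← hQ, ← hR, Finset.sum_const, Finset.card_univ, nsmul_eq_mul]
    rw [e] at h
    have := sub_le_mul_log_sub_mul_log hQ0.le hR0
    linarith
  have hL : |∑ a, (r a - q a) * Real.log (r a / R)| ≤ Fintype.card ι * (s * |Real.log α|) := by
    refine (Finset.abs_sum_le_sum_abs _ _).trans ?_
    rw [← nsmul_eq_mul, ← Finset.card_univ]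
    refine Finset.sum_le_card_nsmul _ _ _ fun a _ => ?_
    rw [abs_mul, abs_sub_comm]
    exact mul_le_mul (hs a) (hlog a) (abs_nonneg _) ((abs_nonneg _).trans (hs a))
  have e : ∑ a, (r a * Real.log (r a / R) - q a * Real.log (q a / Q)) =
      ∑ a, (r a - q a) * Real.log (r a / R) -
        ∑ a, (q a * Real.log (q a / Q) - q a * Real.log (r a / R)) := by
    rw [← Finset.sum_sub_distrib]
    exact Finset.sum_congr rfl fun a _ => by ring
  rw [e, mul_add]
  refine (abs_sub _ _).trans (add_le_add hL ?_)
  rwa [abs_of_nonneg hD0]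

/-- The choice of deviation scale for which the log-likelihood error is at most `t`. -/
theorem scale_bound {k t R α s : ℝ} (hk : 2 ≤ k) (ht : 0 < t) (hR : 0 < R) (hR1 : R ≤ 1)
    (hα : 0 < α) (hα1 : α < 1)
    (hs : s ^ 2 = min t (t ^ 2) * R ^ 2 * α / (8 * k ^ 3 * max 1 (Real.log α ^ 2))) :
    k * (s * |Real.log α| + s ^ 2 / (R * α)) ≤ t := by
  set M := max 1 (Real.log α ^ 2) with hM
  have hM1 : 1 ≤ M := le_max_left _ _
  have hM2 : Real.log α ^ 2 ≤ M := le_max_right _ _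
  have hk0 : 0 < k := by linarith
  have hm0 : 0 ≤ min t (t ^ 2) := by positivity
  have hfirst : k * (s * |Real.log α|) ≤ t / 2 := by
    refine abs_le_of_sq_le_sq' ?_ (by positivity) |>.2
    rw [mul_pow, mul_pow, sq_abs, hs]
    have h1 : min t (t ^ 2) * R ^ 2 * α ≤ t ^ 2 := by
      have : R ^ 2 * α ≤ 1 := by
        have : R ^ 2 ≤ 1 := pow_le_one₀ hR.le hR1
        nlinarith
      calc min t (t ^ 2) * R ^ 2 * α = min t (t ^ 2) * (R ^ 2 * α) := by ring
        _ ≤ t ^ 2 * 1 := mul_le_mul (min_le_right _ _) this (by positivity) (by positivity)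
        _ = t ^ 2 := mul_one _
    calc k ^ 2 * (min t (t ^ 2) * R ^ 2 * α / (8 * k ^ 3 * M) * Real.log α ^ 2)
        ≤ k ^ 2 * (t ^ 2 / (8 * k ^ 3 * M) * M) := by gcongr
      _ = t ^ 2 / (8 * k) := by field_simp
      _ ≤ t ^ 2 / 4 := by gcongr; linarith
      _ = (t / 2) ^ 2 := by ring
  have hsecond : k * (s ^ 2 / (R * α)) ≤ t / 2 := by
    rw [hs]
    calc k * (min t (t ^ 2) * R ^ 2 * α / (8 * k ^ 3 * M) / (R * α))
        = min t (t ^ 2) * R / (8 * k ^ 2 * M) := by field_simp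
      _ ≤ t * 1 / 2 := by
        gcongr
        · exact min_le_left _ _
        · nlinarith [one_le_pow₀ (n := 2) (show 1 ≤ k by linarith)]
      _ = t / 2 := by ring
  linarith


open Finset Real MeasureTheory

variable {A : Type} [Fintype A] [DecidableEq A]

/-- **Deviation bound for the empirical log-likelihood (Corollary, part (b)).**
Under the concentration hypothesis with constant `C > 0`, if `w` is a string with
`ℓ(w) ≤ d`, `p(w) > 0` and `p(a|w) ≥ α₀` for all `a ∈ A` (where `0 < α₀ < 1`), then
setting `L_n(w) = ∑ₐ [p(wa) log p(a|w) - (N_n(w,a)/(n-d)) log p̂_n(a|w)]`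
(convention `0·log 0 = 0`), for every `t > 0` the probability
`P({N_n(w) ≥ 1} ∩ {|L_n(w)| > t})` is at most
`3 e^{1/e} |A|² exp(-(n-d) min(t,t²) p(w)² C α₀ / (8|A|³ max(1,(log α₀)²) (ℓ(w)+1)))`. -/
theorem Ln_deviation_bound {A : Type} [Fintype A] [DecidableEq A]
    [MeasurableSpace A] (hA : 1 < Fintype.card A)
    {Ω : Type} [MeasurableSpace Ω] (P : Measure Ω) [IsProbabilityMeasure P]
    (n d : ℕ) (hd : 0 < d) (hdn : d < n)
    (X : ℕ → Ω → A) (hX : ∀ t, Measurable (X t))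
    (p : List A → ℝ) (hp01 : ∀ u, 0 ≤ p u ∧ p u ≤ 1) (hpnil : p ([] : List A) = 1)
    (hpsum : ∀ u, p u = ∑ b : A, p (u ++ [b]))
    (C : ℝ) (hC : 0 < C)
    (hconc : ∀ u : List A, u.length ≤ d → ∀ a : A, ∀ t : ℝ, 0 < t →
      P {ω | t < |(Nwa (fun s => X s ω) n d u a : ℝ) - ((n : ℝ) - d) * p (u ++ [a])|} ≤
        ENNReal.ofReal (Real.exp (1 / Real.exp 1) *
          Real.exp (-(t ^ 2 * C / (((n : ℝ) - d) * (u.length + 1))))))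
    (w : List A) (hwd : w.length ≤ d) (hpw : 0 < p w)
    (α₀ : ℝ) (hα0 : 0 < α₀) (hα1 : α₀ < 1)
    (hmin : ∀ a : A, α₀ ≤ p (w ++ [a]) / p w)
    (t : ℝ) (ht : 0 < t) :
    P {ω | 1 ≤ Nw (fun s => X s ω) n d w ∧
        t < |∑ a : A, (p (w ++ [a]) * Real.log (p (w ++ [a]) / p w) -
          ((Nwa (fun s => X s ω) n d w a : ℝ) / ((n : ℝ) - d)) *
            Real.log (phat (fun s => X s ω) n d w a))|} ≤
      ENNReal.ofReal (3 * Real.exp (1 / Real.exp 1) * (Fintype.card A : ℝ) ^ 2 *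
        Real.exp (-(((n : ℝ) - d) * min t (t ^ 2) * p w ^ 2 * C * α₀ /
          (8 * (Fintype.card A : ℝ) ^ 3 * max 1 (Real.log α₀ ^ 2) *
            (w.length + 1))))) := by
  classical
  have hm : (0 : ℝ) < (n : ℝ) - d := sub_pos.2 (by exact_mod_cast hdn)
  have hk : (2 : ℝ) ≤ Fintype.card A := by exact_mod_cast hA
  set m : ℝ := (n : ℝ) - d with hmdef
  set k : ℝ := (Fintype.card A : ℝ) with hkdef
  have hk0 : 0 < k := by linarith
  set S : ℝ := min t (t ^ 2) * p w ^ 2 * α₀ / (8 * k ^ 3 * max 1 (Real.log α₀ ^ 2)) with hS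
  have hM : 0 < max 1 (Real.log α₀ ^ 2) := lt_max_of_lt_left one_pos
  have hmin0 : 0 < min t (t ^ 2) := lt_min ht (by positivity)
  have hS0 : 0 < S := by positivity
  have hs0 : 0 < √S := Real.sqrt_pos.2 hS0
  have hs2 : √S ^ 2 = S := Real.sq_sqrt hS0.le
  have hsub : {ω | 1 ≤ Nw (fun s => X s ω) n d w ∧
        t < |∑ a : A, (p (w ++ [a]) * Real.log (p (w ++ [a]) / p w) -
          ((Nwa (fun s => X s ω) n d w a : ℝ) / m) *
            Real.log (phat (fun s => X s ω) n d w a))|} ⊆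
      ⋃ a : A, {ω | m * √S < |(Nwa (fun s => X s ω) n d w a : ℝ) - m * p (w ++ [a])|} := by
    rintro ω ⟨hN, hL⟩
    by_contra hcon
    simp only [Set.mem_iUnion, Set.mem_ofPred_eq, not_exists, not_lt] at hcon
    refine hL.not_ge ?_
    have hN0 : (0 : ℝ) < Nw (fun s => X s ω) n d w := by exact_mod_cast hN
    have h := abs_sum_mul_log_sub_le
      (q := fun a => (Nwa (fun s => X s ω) n d w a : ℝ) / m) (r := fun a => p (w ++ [a]))
      (Q := (Nw (fun s => X s ω) n d w : ℝ) / m) (s := √S)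
      (fun a => by positivity) (by rw [← Finset.sum_div, Nw, Nat.cast_sum])
      (div_pos hN0 hm) (hpsum w) hpw hα0 hmin (fun a => by
        have e : (Nwa (fun s => X s ω) n d w a : ℝ) / m - p (w ++ [a]) =
            ((Nwa (fun s => X s ω) n d w a : ℝ) - m * p (w ++ [a])) / m := by field_simp
        rw [e, abs_div, abs_of_pos hm, div_le_iff₀ hm, mul_comm (√S)]
        exact hcon a)
    simp only [div_div_div_cancel_right₀ hm.ne'] at h
    exact h.trans (scale_bound hk ht hpw (hp01 w).2 hα0 hα1 hs2)
  have hexp : (m * √S) ^ 2 * C / (m * (w.length + 1)) =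
      m * min t (t ^ 2) * p w ^ 2 * C * α₀ /
        (8 * k ^ 3 * max 1 (Real.log α₀ ^ 2) * (w.length + 1)) := by
    rw [mul_pow, hs2, hS]
    field_simp
  refine (measure_mono hsub).trans ((measure_iUnion_fintype_le _ _).trans ?_)
  refine (Finset.sum_le_sum fun a _ => hconc w hwd a _ (mul_pos hm hs0)).trans ?_
  rw [hexp, Finset.sum_const, Finset.card_univ, nsmul_eq_mul, ← ENNReal.ofReal_natCast,
    ← ENNReal.ofReal_mul (by positivity), ← hkdef, ← mul_assoc]
  refine ENNReal.ofReal_le_ofReal (mul_le_mul_of_nonneg_right ?_ (Real.exp_pos _).le)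
  have he := Real.exp_pos (1 / Real.exp 1)
  have hkk : k ≤ 3 * k ^ 2 := by nlinarith
  calc k * Real.exp (1 / Real.exp 1) ≤ 3 * k ^ 2 * Real.exp (1 / Real.exp 1) := by gcongr
    _ = 3 * Real.exp (1 / Real.exp 1) * k ^ 2 := by ring
end

section
/- Under the concentration hypothesis with constant C > 0, let w be a string with 0 ≤ ℓ(w) ≤ d and p(w) > 0, and suppose there is α₀ ∈ (0,1) with p(a|w) ≥ α₀ for every a ∈ A. Then for every t > 0: P( | ∑_{a∈A} log p(a|w) · ( p(wa) − N_n(w,a)/(n−d) ) | > t/2 ) ≤ e^{1/e} |A| exp( −(n−d) t² C / (4 |A|² (log α₀)² (ℓ(w)+1)) ). -/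
open Finset Real MeasureTheory

variable {A : Type} [Fintype A] [DecidableEq A]

/-- If a weighted sum with weights bounded by `L` exceeds `r`, then some term exceeds the
average share `r / (|ι| L)`. -/
theorem exists_lt_abs_of_lt_abs_sum_mul {ι : Type*} [Fintype ι] {f g : ι → ℝ} {L r : ℝ}
    (hL : 0 < L) (hr : 0 ≤ r) (hf : ∀ i, |f i| ≤ L) (h : r < |∑ i, f i * g i|) :
    ∃ i, r / (Fintype.card ι * L) < |g i| := by
  by_contra! hg
  refine h.not_ge ?_
  rcases isEmpty_or_nonempty ι with _ | _
  · simpa using hr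
  calc |∑ i, f i * g i| ≤ ∑ i, |f i * g i| := Finset.abs_sum_le_sum_abs _ _
    _ ≤ ∑ _i : ι, L * (r / (Fintype.card ι * L)) := by
        refine Finset.sum_le_sum fun i _ => ?_
        rw [abs_mul]
        exact mul_le_mul (hf i) (hg i) (abs_nonneg _) hL.le
    _ = r := by
        rw [Finset.sum_const, Finset.card_univ, nsmul_eq_mul]
        field_simp

/-- The union bound for a finite family of events of probability at most `c`. -/
theorem measure_le_card_mul_of_subset_iUnion {Ω ι : Type*} [MeasurableSpace Ω] [Fintype ι]
    {P : Measure Ω} {S : Set Ω} {T : ι → Set Ω} {c : ℝ}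
    (hS : S ⊆ ⋃ i, T i) (hT : ∀ i, P (T i) ≤ ENNReal.ofReal c) :
    P S ≤ ENNReal.ofReal (Fintype.card ι * c) := by
  calc P S ≤ P (⋃ i, T i) := measure_mono hS
    _ ≤ ∑ i, P (T i) := measure_iUnion_fintype_le P T
    _ ≤ ∑ _i : ι, ENNReal.ofReal c := Finset.sum_le_sum fun i _ => hT i
    _ = ENNReal.ofReal (Fintype.card ι * c) := by
        rw [ENNReal.ofReal_mul (Nat.cast_nonneg _), ENNReal.ofReal_natCast, Finset.sum_const,
          Finset.card_univ, nsmul_eq_mul]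

/-- For `α ≤ x ≤ 1` with `α > 0`, the logarithm of `x` is bounded by that of `α`. -/
theorem abs_log_le_neg_log {α x : ℝ} (hα : 0 < α) (hαx : α ≤ x) (hx : x ≤ 1) :
    |Real.log x| ≤ -Real.log α := by
  rw [abs_of_nonpos (Real.log_nonpos (hα.le.trans hαx) hx)]
  exact neg_le_neg (Real.log_le_log hα hαx)

/-- **Deviation bound for the linear part of `L_n(w)` (inequality (13) in the proof of
the Corollary).**  Under the concentration hypothesis with constant `C > 0`, if `w`
is a string with `ℓ(w) ≤ d`, `p(w) > 0` and `p(a|w) ≥ α₀` for all `a ∈ A` (where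
`0 < α₀ < 1`), then for every `t > 0`,
`P(|∑ₐ log p(a|w) (p(wa) - N_n(w,a)/(n-d))| > t/2)` is at most
`e^{1/e} |A| exp(-(n-d) t² C / (4|A|² (log α₀)² (ℓ(w)+1)))`. -/
theorem linear_part_deviation_bound {A : Type} [Fintype A] [DecidableEq A]
    [MeasurableSpace A] (hA : 1 < Fintype.card A)
    {Ω : Type} [MeasurableSpace Ω] (P : Measure Ω) [IsProbabilityMeasure P]
    (n d : ℕ) (hd : 0 < d) (hdn : d < n)
    (X : ℕ → Ω → A) (hX : ∀ t, Measurable (X t))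
    (p : List A → ℝ) (hp01 : ∀ u, 0 ≤ p u ∧ p u ≤ 1) (hpnil : p ([] : List A) = 1)
    (hpsum : ∀ u, p u = ∑ b : A, p (u ++ [b]))
    (C : ℝ) (hC : 0 < C)
    (hconc : ∀ u : List A, u.length ≤ d → ∀ a : A, ∀ t : ℝ, 0 < t →
      P {ω | t < |(Nwa (fun s => X s ω) n d u a : ℝ) - ((n : ℝ) - d) * p (u ++ [a])|} ≤
        ENNReal.ofReal (Real.exp (1 / Real.exp 1) *
          Real.exp (-(t ^ 2 * C / (((n : ℝ) - d) * (u.length + 1))))))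
    (w : List A) (hwd : w.length ≤ d) (hpw : 0 < p w)
    (α₀ : ℝ) (hα0 : 0 < α₀) (hα1 : α₀ < 1)
    (hmin : ∀ a : A, α₀ ≤ p (w ++ [a]) / p w)
    (t : ℝ) (ht : 0 < t) :
    P {ω | t / 2 < |∑ a : A, Real.log (p (w ++ [a]) / p w) *
        (p (w ++ [a]) - (Nwa (fun s => X s ω) n d w a : ℝ) / ((n : ℝ) - d))|} ≤
      ENNReal.ofReal (Real.exp (1 / Real.exp 1) * (Fintype.card A : ℝ) *
        Real.exp (-(((n : ℝ) - d) * t ^ 2 * C /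
          (4 * (Fintype.card A : ℝ) ^ 2 * Real.log α₀ ^ 2 * (w.length + 1))))) := by
  have hm : (0 : ℝ) < (n : ℝ) - d := sub_pos.2 (by exact_mod_cast hdn)
  have hK : (0 : ℝ) < Fintype.card A := by exact_mod_cast zero_lt_one.trans hA
  have hL : 0 < -Real.log α₀ := neg_pos.2 (Real.log_neg hα0 hα1)
  have hlog (a : A) : |Real.log (p (w ++ [a]) / p w)| ≤ -Real.log α₀ := by
    refine abs_log_le_neg_log hα0 (hmin a) ((div_le_one hpw).2 ?_)
    rw [hpsum w]
    exact Finset.single_le_sum (fun b _ => (hp01 (w ++ [b])).1) (Finset.mem_univ a)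
  set m : ℝ := (n : ℝ) - d with hm_def
  set s : ℝ := m * (t / 2 / (Fintype.card A * -Real.log α₀)) with hs_def
  have hs : 0 < s := by positivity
  have hexp : s ^ 2 * C / (m * (w.length + 1)) =
      m * t ^ 2 * C / (4 * (Fintype.card A : ℝ) ^ 2 * Real.log α₀ ^ 2 * (w.length + 1)) := by
    have := (neg_pos.1 hL).ne
    rw [hs_def]
    field_simp
    norm_num
  have hbound (a : A) := hconc w hwd a s hs
  rw [hexp] at hbound
  rw [mul_comm (Real.exp (1 / Real.exp 1)), mul_assoc]
  refine measure_le_card_mul_of_subset_iUnion (fun ω hω => ?_) hbound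
  obtain ⟨a, ha⟩ := exists_lt_abs_of_lt_abs_sum_mul hL (half_pos ht).le hlog hω
  refine Set.mem_iUnion.2 ⟨a, ?_⟩
  calc s < m * |p (w ++ [a]) - (Nwa (fun s => X s ω) n d w a : ℝ) / m| :=
        mul_lt_mul_of_pos_left ha hm
    _ = |(Nwa (fun s => X s ω) n d w a : ℝ) - m * p (w ++ [a])| := by
        rw [← abs_of_pos hm, ← abs_mul, abs_of_pos hm, mul_sub, mul_div_cancel₀ _ hm.ne',
          abs_sub_comm]
end

section
/- Under the concentration hypothesis with constant C > 0, let w be a string with 0 ≤ ℓ(w) ≤ d and p(w) > 0, and suppose there is α₀ ∈ (0,1) with p(a|w) ≥ α₀ for every a ∈ A. Then for every t > 0: P( {N_n(w) ≥ 1} ∩ { | ∑_{a∈A} (N_n(w,a)/(n−d)) log( p(a|w)/p̂_n(a|w) ) | > t/2 } ) ≤ 2 e^{1/e} |A|² exp( −(n−d) t p(w)² C α₀ / (8 |A|³ (ℓ(w)+1)) ), where terms with N_n(w,a) = 0 are taken equal to 0. -/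
open Finset Real MeasureTheory

variable {A : Type} [Fintype A] [DecidableEq A]

/-- A relative entropy with unnormalised first argument is at most the corresponding
chi-square quantity. -/
theorem abs_sum_mul_log_div_le {A : Type} [Fintype A] (m q : A → ℝ) (M N : ℝ)
    (hm : ∀ a, 0 ≤ m a) (hM : ∑ a, m a = M) (hM0 : 0 < M) (hN : 0 < N)
    (hq : ∀ a, 0 < q a) (hq1 : ∑ a, q a = 1) :
    |∑ a, m a / N * Real.log (q a / (m a / M))| ≤ (∑ a, m a ^ 2 / q a - M ^ 2) / (N * M) := by
  have hupper : ∑ a, m a / N * Real.log (q a / (m a / M)) ≤ 0 := by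
    have hterm : ∀ a, m a / N * Real.log (q a / (m a / M)) ≤ (M * q a - m a) / N := by
      intro a
      rcases (hm a).eq_or_lt with h | h
      · have := hq a
        rw [← h]
        simp only [zero_div, zero_mul, sub_zero]
        positivity
      · have hlog := Real.log_le_sub_one_of_pos (div_pos (hq a) (div_pos h hM0))
        calc m a / N * Real.log (q a / (m a / M))
            ≤ m a / N * (q a / (m a / M) - 1) :=
              mul_le_mul_of_nonneg_left hlog (by positivity)
          _ = (M * q a - m a) / N := by field_simp
    refine (Finset.sum_le_sum fun a _ => hterm a).trans ?_
    rw [← Finset.sum_div, Finset.sum_sub_distrib, ← Finset.mul_sum, hq1, hM]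
    simp
  have hlower : (∑ a, -(m a / N * Real.log (q a / (m a / M)))) ≤
      (∑ a, m a ^ 2 / q a - M ^ 2) / (N * M) := by
    have hterm : ∀ a, -(m a / N * Real.log (q a / (m a / M))) ≤
        (m a ^ 2 / q a - M * m a) / (N * M) := by
      intro a
      rcases (hm a).eq_or_lt with h | h
      · rw [← h]
        simp
      · have hqa := hq a
        have hlog := Real.log_le_sub_one_of_pos (div_pos (div_pos h hM0) hqa)
        rw [← mul_neg, ← Real.log_inv, inv_div]
        calc m a / N * Real.log (m a / M / q a)
            ≤ m a / N * (m a / M / q a - 1) :=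
              mul_le_mul_of_nonneg_left hlog (by positivity)
          _ = (m a ^ 2 / q a - M * m a) / (N * M) := by field_simp
    refine (Finset.sum_le_sum fun a _ => hterm a).trans (le_of_eq ?_)
    rw [← Finset.sum_div, Finset.sum_sub_distrib, ← Finset.mul_sum, hM, sq M]
  rw [abs_of_nonpos hupper, ← Finset.sum_neg_distrib]
  exact hlower

/-- If all counts `m a` are within `s` of `N * r * q a`, then the divergence of the normalised
counts from `q`, scaled by the total count over `N`, is at most `t / 2`. -/
theorem abs_sum_mul_log_div_le_of_abs_sub_le {A : Type} [Fintype A] (hA : 1 < Fintype.card A)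
    (m q : A → ℝ) (M N r α t s : ℝ)
    (hm : ∀ a, 0 ≤ m a) (hM : ∑ a, m a = M) (hM0 : 0 < M) (hN : 0 < N)
    (hr : 0 < r) (hr1 : r ≤ 1) (hα : 0 < α) (hq : ∀ a, α ≤ q a) (hq1 : ∑ a, q a = 1)
    (ht : 0 < t) (hs : s ^ 2 = N ^ 2 * t * r ^ 2 * α / (8 * (Fintype.card A : ℝ) ^ 3))
    (hdev : ∀ a, |m a - N * r * q a| ≤ s) :
    |∑ a, m a / N * Real.log (q a / (m a / M))| ≤ t / 2 := by
  have hq0 : ∀ a, 0 < q a := fun a => hα.trans_le (hq a)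
  have hchi := abs_sum_mul_log_div_le m q M N hm hM hM0 hN hq0 hq1
  have hk : (2 : ℝ) ≤ Fintype.card A := by exact_mod_cast hA
  set k : ℝ := (Fintype.card A : ℝ) with hkdef
  have hk0 : 0 < k := by linarith
  have hdevsum : ∑ a, (m a - N * r * q a) = M - N * r := by
    rw [Finset.sum_sub_distrib, ← Finset.mul_sum, hq1, hM, mul_one]
  rcases le_or_gt (N * r ^ 2 / (4 * k ^ 2)) M with hcase | hcase
  · refine hchi.trans ?_
    have hexpand : ∑ a, m a ^ 2 / q a =
        ∑ a, (m a - N * r * q a) ^ 2 / q a + 2 * (N * r) * M - (N * r) ^ 2 := by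
      have hterm : ∀ a, m a ^ 2 / q a =
          (m a - N * r * q a) ^ 2 / q a + 2 * (N * r) * m a - (N * r) ^ 2 * q a := by
        intro a
        have := (hq0 a).ne'
        field_simp
        ring
      rw [Finset.sum_congr rfl fun a _ => hterm a, Finset.sum_sub_distrib,
        Finset.sum_add_distrib, ← Finset.mul_sum, ← Finset.mul_sum, hq1, hM, mul_one]
    have hsq : ∑ a, (m a - N * r * q a) ^ 2 / q a ≤ k * (s ^ 2 / α) := by
      calc ∑ a, (m a - N * r * q a) ^ 2 / q a ≤ ∑ _a : A, s ^ 2 / α := by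
            refine Finset.sum_le_sum fun a _ => ?_
            exact div_le_div₀ (sq_nonneg s) (sq_le_sq' (abs_le.1 (hdev a)).1 (abs_le.1 (hdev a)).2)
              hα (hq a)
        _ = k * (s ^ 2 / α) := by simp [hkdef]
    have hval : k * (s ^ 2 / α) = N * t / 2 * (N * r ^ 2 / (4 * k ^ 2)) := by
      rw [hs]
      field_simp
      ring
    have hle := mul_le_mul_of_nonneg_left hcase (by positivity : 0 ≤ N * t / 2)
    rw [div_le_iff₀ (by positivity)]
    nlinarith [sq_nonneg (M - N * r)]
  · by_contra! hgt
    have hMsmall : M ≤ N * r / 16 := by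
      refine hcase.le.trans ?_
      rw [div_le_div_iff₀ (by positivity) (by norm_num)]
      have h1 : r ^ 2 ≤ r := by nlinarith
      have h2 : 4 ≤ k ^ 2 := by nlinarith
      nlinarith [mul_le_mul_of_nonneg_left h1 hN.le,
        mul_le_mul_of_nonneg_left h2 (mul_pos hN hr).le]
    have hMN : M ≤ N := by nlinarith
    have hsum : ∑ a, m a ^ 2 / q a ≤ M ^ 2 / α := by
      calc ∑ a, m a ^ 2 / q a ≤ ∑ a, M * m a / α := by
            refine Finset.sum_le_sum fun a _ => ?_
            have hma : m a ≤ M :=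
              hM ▸ Finset.single_le_sum (fun b _ => hm b) (Finset.mem_univ a)
            exact div_le_div₀ (mul_nonneg hM0.le (hm a))
              (by rw [sq]; exact mul_le_mul_of_nonneg_right hma (hm a)) hα (hq a)
        _ = M ^ 2 / α := by rw [← Finset.sum_div, ← Finset.mul_sum, hM, sq]
    have htα : t * α < 2 := by
      have h1 : t / 2 < 1 / α := by
        calc t / 2 < (∑ a, m a ^ 2 / q a - M ^ 2) / (N * M) := hgt.trans_le hchi
          _ ≤ (M ^ 2 / α) / (N * M) := by
            gcongr
            nlinarith [sq_nonneg M]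
          _ = M / N * (1 / α) := by field_simp
          _ ≤ 1 * (1 / α) := by
            gcongr
            exact (div_le_one hN).2 hMN
          _ = 1 / α := one_mul _
      rw [div_lt_div_iff₀ (by norm_num) hα] at h1
      linarith
    have hks : N * r - M ≤ k * s := by
      calc N * r - M ≤ |∑ a, (m a - N * r * q a)| := by
            rw [hdevsum, abs_sub_comm]
            exact le_abs_self _
        _ ≤ ∑ a, |m a - N * r * q a| := Finset.abs_sum_le_sum_abs _ _
        _ ≤ ∑ _a : A, s := Finset.sum_le_sum fun a _ => hdev a
        _ = k * s := by simp [hkdef]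
    have hNr : 0 < N * r := mul_pos hN hr
    have hlow : (15 / 16 * (N * r)) ^ 2 ≤ (k * s) ^ 2 :=
      pow_le_pow_left₀ (by positivity) (by linarith) 2
    have hup : (k * s) ^ 2 ≤ (N * r) ^ 2 / 8 := by
      have : (k * s) ^ 2 = (N * r) ^ 2 * (t * α) / (8 * k) := by
        rw [mul_pow, hs]
        field_simp
      rw [this, div_le_div_iff₀ (by positivity) (by norm_num)]
      nlinarith [mul_le_mul_of_nonneg_left (htα.le.trans hk) (sq_nonneg (N * r))]
    nlinarith [sq_pos_of_pos hNr]

/-- **Deviation bound for the divergence part of `L_n(w)` (inequality (14) in the proof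
of the Corollary).**  Under the concentration hypothesis with constant `C > 0`, if `w`
is a string with `ℓ(w) ≤ d`, `p(w) > 0` and `p(a|w) ≥ α₀` for all `a ∈ A` (where
`0 < α₀ < 1`), then for every `t > 0`,
`P({N_n(w) ≥ 1} ∩ {|∑ₐ (N_n(w,a)/(n-d)) log (p(a|w)/p̂_n(a|w))| > t/2})` is at most
`2 e^{1/e} |A|² exp(-(n-d) t p(w)² C α₀ / (8|A|³ (ℓ(w)+1)))`
(terms with `N_n(w,a) = 0` are taken equal to `0`). -/
theorem divergence_part_deviation_bound {A : Type} [Fintype A] [DecidableEq A]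
    [MeasurableSpace A] (hA : 1 < Fintype.card A)
    {Ω : Type} [MeasurableSpace Ω] (P : Measure Ω) [IsProbabilityMeasure P]
    (n d : ℕ) (hd : 0 < d) (hdn : d < n)
    (X : ℕ → Ω → A) (hX : ∀ t, Measurable (X t))
    (p : List A → ℝ) (hp01 : ∀ u, 0 ≤ p u ∧ p u ≤ 1) (hpnil : p ([] : List A) = 1)
    (hpsum : ∀ u, p u = ∑ b : A, p (u ++ [b]))
    (C : ℝ) (hC : 0 < C)
    (hconc : ∀ u : List A, u.length ≤ d → ∀ a : A, ∀ t : ℝ, 0 < t →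
      P {ω | t < |(Nwa (fun s => X s ω) n d u a : ℝ) - ((n : ℝ) - d) * p (u ++ [a])|} ≤
        ENNReal.ofReal (Real.exp (1 / Real.exp 1) *
          Real.exp (-(t ^ 2 * C / (((n : ℝ) - d) * (u.length + 1))))))
    (w : List A) (hwd : w.length ≤ d) (hpw : 0 < p w)
    (α₀ : ℝ) (hα0 : 0 < α₀) (hα1 : α₀ < 1)
    (hmin : ∀ a : A, α₀ ≤ p (w ++ [a]) / p w)
    (t : ℝ) (ht : 0 < t) :
    P {ω | 1 ≤ Nw (fun s => X s ω) n d w ∧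
        t / 2 < |∑ a : A, ((Nwa (fun s => X s ω) n d w a : ℝ) / ((n : ℝ) - d)) *
          Real.log ((p (w ++ [a]) / p w) / phat (fun s => X s ω) n d w a)|} ≤
      ENNReal.ofReal (2 * Real.exp (1 / Real.exp 1) * (Fintype.card A : ℝ) ^ 2 *
        Real.exp (-(((n : ℝ) - d) * t * p w ^ 2 * C * α₀ /
          (8 * (Fintype.card A : ℝ) ^ 3 * (w.length + 1))))) := by
  have hN : (0 : ℝ) < (n : ℝ) - d := sub_pos.2 (by exact_mod_cast hdn)
  have hk : (2 : ℝ) ≤ Fintype.card A := by exact_mod_cast hA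
  set N : ℝ := (n : ℝ) - d
  set k : ℝ := (Fintype.card A : ℝ) with hkdef
  have hk0 : 0 < k := by linarith
  set s : ℝ := √(N ^ 2 * t * p w ^ 2 * α₀ / (8 * k ^ 3)) with hsdef
  have hs0 : 0 < s := Real.sqrt_pos.2 (by positivity)
  have hs : s ^ 2 = N ^ 2 * t * p w ^ 2 * α₀ / (8 * k ^ 3) := Real.sq_sqrt (by positivity)
  have hq1 : ∑ a, p (w ++ [a]) / p w = 1 := by
    rw [← Finset.sum_div, ← hpsum, div_self hpw.ne']
  have hexp : s ^ 2 * C / (N * (w.length + 1)) =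
      N * t * p w ^ 2 * C * α₀ / (8 * k ^ 3 * (w.length + 1)) := by
    rw [hs]
    field_simp
  have hsub : {ω | 1 ≤ Nw (fun s => X s ω) n d w ∧
        t / 2 < |∑ a : A, ((Nwa (fun s => X s ω) n d w a : ℝ) / N) *
          Real.log ((p (w ++ [a]) / p w) / phat (fun s => X s ω) n d w a)|} ⊆
      ⋃ a : A, {ω | s < |(Nwa (fun s => X s ω) n d w a : ℝ) - N * p (w ++ [a])|} := by
    rintro ω ⟨hpos, hgt⟩
    by_contra hnot
    simp only [Set.mem_iUnion, Set.mem_ofPred_eq, not_exists, not_lt] at hnot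
    refine hgt.not_ge (abs_sum_mul_log_div_le_of_abs_sub_le hA
      (fun a => (Nwa (fun s => X s ω) n d w a : ℝ)) (fun a => p (w ++ [a]) / p w)
      (Nw (fun s => X s ω) n d w) N (p w) α₀ t s (fun a => Nat.cast_nonneg _)
      (by simp [Nw]) (by exact_mod_cast hpos) hN hpw (hp01 w).2 hα0 hmin hq1 ht hs fun a => ?_)
    rw [mul_assoc, mul_div_cancel₀ _ hpw.ne']
    exact hnot a
  refine (measure_mono hsub).trans ((measure_iUnion_fintype_le P _).trans ?_)
  refine (Finset.sum_le_sum fun a _ => hconc w hwd a s hs0).trans ?_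
  rw [hexp, Finset.sum_const, nsmul_eq_mul, Finset.card_univ, ← ENNReal.ofReal_natCast,
    ← ENNReal.ofReal_mul (Nat.cast_nonneg _), ← hkdef]
  refine ENNReal.ofReal_le_ofReal ?_
  rw [← mul_assoc, mul_comm k, mul_comm 2, mul_assoc _ 2]
  gcongr
  nlinarith
end

section
/- Under the concentration hypothesis with constant C > 0, suppose there is α₀ ∈ (0,1) such that p(a|u) ≥ α₀ for every string u and every a ∈ A. Let w be a string and let τ' be a finite set of strings such that: every u ∈ τ' satisfies w ≺ u and ℓ(u) ≤ d; no element of τ' is a suffix of another element of τ'; p(wa) = ∑_{u∈τ'} p(ua) for every a ∈ A; and δ := ∑_{a∈A} [ ∑_{u∈τ'} p(ua) log p(a|u) − p(wa) log p(a|w) ] > 0. Then there exist constants c₁ > 0 and c₂ > 0, depending only on |A|, C, α₀, δ, |τ'| and h(τ') (the maximal length of elements of τ'), such that whenever f(n) > 0 satisfies |τ'| f(n)/(n−d) < δ/2, P( { τ' ∈ F^d_w(X_1^n) } ∩ { χ_w(X_1^n) = 0 } ) ≤ c₁ exp( −c₂ (n−d) ). -/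
open Finset Real MeasureTheory

variable {A : Type} [Fintype A] [DecidableEq A]

/-- Gibbs' inequality for unnormalized weights. -/
lemma gibbs_inequality {ι : Type*} [Fintype ι] (N P : ι → ℝ) (hN : ∀ a, 0 ≤ N a)
    (hP : ∀ a, 0 < P a) :
    ∑ a, N a * log (P a / ∑ b, P b) ≤ ∑ a, N a * log (N a / ∑ b, N b) := by
  set S := ∑ b, N b with hS
  set T := ∑ b, P b with hT
  have key : ∀ a, N a * log (P a / T) - N a * log (N a / S) ≤ P a / T * S - N a := by
    intro a
    have hT0 : 0 < T := Finset.sum_pos (fun b _ => hP b) ⟨a, Finset.mem_univ a⟩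
    rcases (hN a).eq_or_lt with h | h
    · have hS0 : 0 ≤ S := Finset.sum_nonneg fun b _ => hN b
      have := hP a
      rw [← h]
      simp only [zero_mul, sub_zero]
      positivity
    · have hS0 : 0 < S :=
        Finset.sum_pos' (fun b _ => hN b) ⟨a, Finset.mem_univ a, h⟩
      have hPa := hP a
      rw [← mul_sub, ← log_div (by positivity) (by positivity)]
      calc N a * log (P a / T / (N a / S))
          ≤ N a * (P a / T / (N a / S) - 1) :=
            mul_le_mul_of_nonneg_left (log_le_sub_one_of_pos (by positivity)) h.le
        _ = P a / T * S - N a := by field_simp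
  have hsum := Finset.sum_le_sum fun a (_ : a ∈ Finset.univ) => key a
  rw [Finset.sum_sub_distrib, Finset.sum_sub_distrib, ← Finset.sum_mul, ← Finset.sum_div,
    ← hT, ← hS] at hsum
  have : T / T * S ≤ S := by
    have hS0 : 0 ≤ S := Finset.sum_nonneg fun b _ => hN b
    exact mul_le_of_le_one_left hS0 (div_self_le_one T)
  linarith

/-- The unnormalized relative entropy is bounded by the chi-square divergence. -/
lemma sum_mul_log_le_add_chi_square {ι : Type*} [Fintype ι] (N P : ι → ℝ)
    (hN : ∀ a, 0 ≤ N a) (hP : ∀ a, 0 < P a) :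
    ∑ a, N a * log (N a / ∑ b, N b) ≤
      ∑ a, N a * log (P a / ∑ b, P b) + ∑ a, (N a - P a) ^ 2 / P a := by
  set S := ∑ b, N b with hS
  set T := ∑ b, P b with hT
  have hS0 : 0 ≤ S := Finset.sum_nonneg fun b _ => hN b
  have hT0 : 0 ≤ T := Finset.sum_nonneg fun b _ => (hP b).le
  have key : ∀ a, N a * log (N a / S) - N a * log (P a / T) ≤
      (N a - P a) ^ 2 / P a + (N a - P a) + N a * log (T / S) := by
    intro a
    have hPa := hP a
    have hTpos : 0 < T := Finset.sum_pos (fun b _ => hP b) ⟨a, Finset.mem_univ a⟩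
    rcases (hN a).eq_or_lt with h | h
    · rw [← h]
      have : (0 - P a) ^ 2 / P a = P a := by field_simp; ring
      rw [this]
      simp
    · have hSpos : 0 < S :=
        Finset.sum_pos' (fun b _ => hN b) ⟨a, Finset.mem_univ a, h⟩
      have hlog : log (N a / S) - log (P a / T) = log (N a / P a) + log (T / S) := by
        rw [log_div, log_div, log_div, log_div] <;> first | positivity | ring
      have := mul_le_mul_of_nonneg_left
        (log_le_sub_one_of_pos (show 0 < N a / P a by positivity)) h.le
      have hring : N a * (N a / P a - 1) = (N a - P a) ^ 2 / P a + (N a - P a) := by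
        field_simp; ring
      rw [← mul_sub, hlog, mul_add]
      linarith
  have hsum := Finset.sum_le_sum fun a (_ : a ∈ Finset.univ) => key a
  rw [Finset.sum_sub_distrib, Finset.sum_add_distrib, Finset.sum_add_distrib,
    Finset.sum_sub_distrib, ← Finset.sum_mul, ← hT, ← hS] at hsum
  have hST : S * log (T / S) ≤ T - S := by
    rcases hS0.eq_or_lt with h | h
    · rw [← h]; simpa using hT0
    · rcases hT0.eq_or_lt with h' | h'
      · exfalso
        have : ∀ a ∈ (Finset.univ : Finset ι), P a = 0 :=
          (Finset.sum_eq_zero_iff_of_nonneg fun a _ => (hP a).le).1 h'.symm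
        have hne : (Finset.univ : Finset ι).Nonempty := by
          by_contra hne
          rw [Finset.not_nonempty_iff_eq_empty] at hne
          rw [hS, hne] at h
          simp at h
        obtain ⟨a, ha⟩ := hne
        exact (hP a).ne' (this a ha)
      · calc S * log (T / S) ≤ S * (T / S - 1) :=
              mul_le_mul_of_nonneg_left (log_le_sub_one_of_pos (by positivity)) h.le
          _ = T - S := by field_simp
  linarith

section Counts

variable {x : ℕ → A} {n d : ℕ}

lemma Nwa_le_of_suffix {B : Type} [DecidableEq B] {x : ℕ → B} {v u : List B}
    (h : v <:+ u) (hu : u.length ≤ d) (a : B) :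
    Nwa x n d u a ≤ Nwa x n d v a := by
  obtain ⟨r, rfl⟩ := h
  refine Finset.card_le_card fun t ht => ?_
  simp only [Finset.mem_filter, Finset.mem_Icc] at ht ⊢
  refine ⟨ht.1, fun i => ?_, ht.2.2⟩
  have hi := ht.2.1 ⟨r.length + i, by simp⟩
  rw [List.length_append] at hu
  have hidx : t - (r ++ v).length + (r.length + i) = t - v.length + i := by
    rw [List.length_append]; omega
  rw [hidx] at hi
  simpa using hi

lemma Nw_le_of_suffix {v u : List A} (h : v <:+ u) (hu : u.length ≤ d) :
    Nw x n d u ≤ Nw x n d v :=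
  Finset.sum_le_sum fun a _ => Nwa_le_of_suffix h hu a

lemma phat_pow_pos (w : List A) (a : A) : 0 < phat x n d w a ^ Nwa x n d w a := by
  rcases Nat.eq_zero_or_pos (Nwa x n d w a) with h | h
  · simp [h]
  · have : 0 < Nw x n d w :=
      h.trans_le (Finset.single_le_sum (f := Nwa x n d w) (fun _ _ => Nat.zero_le _)
        (Finset.mem_univ a))
    unfold phat
    positivity

lemma Pml_pos (w : List A) : 0 < Pml x n d w :=
  Finset.prod_pos fun a _ => phat_pow_pos w a

lemma log_Pml (w : List A) :
    log (Pml x n d w) =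
      ∑ a, (Nwa x n d w a : ℝ) * log ((Nwa x n d w a : ℝ) / ∑ b, (Nwa x n d w b : ℝ)) := by
  rw [Pml, log_prod fun a _ => (phat_pow_pos w a).ne']
  refine Finset.sum_congr rfl fun a _ => ?_
  rw [log_pow, phat, Nw]
  push_cast
  rfl

end Counts

section Tree

variable {x : ℕ → A} {n d : ℕ} {f : ℝ} {w : List A} {τ : Finset (List A)}

lemma exists_cons_suffix_of_ne {B : Type*} {v u : List B} (h : v <:+ u) (hne : v ≠ u) :
    ∃ a, (a :: v) <:+ u := by
  obtain ⟨r, rfl⟩ := h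
  rcases List.eq_nil_or_concat r with rfl | ⟨r, a, rfl⟩
  · simp at hne
  · exact ⟨a, r, by simp⟩

lemma prod_filter_suffix_eq (g : List A → ℝ) {v : List A} (hv : v ∉ τ) :
    ∏ u ∈ τ with v <:+ u, g u = ∏ a : A, ∏ u ∈ τ with (a :: v) <:+ u, g u := by
  rw [← Finset.prod_biUnion]
  · refine Finset.prod_congr ?_ fun _ _ => rfl
    ext u
    simp only [Finset.mem_filter, Finset.mem_biUnion, Finset.mem_univ, true_and]
    constructor
    · rintro ⟨hu, hvu⟩
      obtain ⟨a, ha⟩ := exists_cons_suffix_of_ne hvu (fun h => hv (h ▸ hu))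
      exact ⟨a, hu, ha⟩
    · rintro ⟨a, hu, ha⟩
      exact ⟨hu, (List.suffix_cons a v).trans ha⟩
  · intro a _ b _ hab
    refine Finset.disjoint_left.2 fun u ha hb => hab ?_
    have ha' := (Finset.mem_filter.1 ha).2
    have hb' := (Finset.mem_filter.1 hb).2
    have := (List.suffix_of_suffix_length_le ha' hb' (by simp)).eq_of_length (by simp)
    exact (List.cons.inj this).1

lemma prod_filter_le_prod_children (hτ : τ ∈ Fdw x n d w) {v : List A} (hv : v ∉ τ)
    (hchild : ∀ a, 1 ≤ Nw x n d (a :: v) →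
      ∏ u ∈ τ with (a :: v) <:+ u, exp (-f) * Pml x n d u ≤ V x n d f (a :: v)) :
    ∏ u ∈ τ with v <:+ u, exp (-f) * Pml x n d u ≤
      ∏ a : A, if 1 ≤ Nw x n d (a :: v) then V x n d f (a :: v) else 1 := by
  rw [prod_filter_suffix_eq _ hv]
  refine Finset.prod_le_prod
    (fun a _ => Finset.prod_nonneg fun u _ => (mul_pos (exp_pos _) (Pml_pos u)).le)
    fun a _ => ?_
  split_ifs with h
  · exact hchild a h
  · rw [Finset.filter_false_of_mem, Finset.prod_empty]
    intro u hu hau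
    obtain ⟨-, hlen, hN⟩ := hτ.2.1 u hu
    exact h (hN.trans (Nw_le_of_suffix hau hlen))

lemma exists_cons_suffix_mem (hτ : τ ∈ Fdw x n d w) {v : List A} (hwv : w <:+ v)
    (hv : v ∉ τ) (hex : ∃ u ∈ τ, v <:+ u) {a : A} (ha : 1 ≤ Nw x n d (a :: v)) :
    ∃ u ∈ τ, (a :: v) <:+ u := by
  obtain ⟨u, hu, hvu⟩ := hex
  have hne : v ≠ u := fun h => hv (h ▸ hu)
  have hlt : v.length < u.length := lt_of_le_of_ne hvu.length_le
    fun h => hne (hvu.eq_of_length h)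
  rcases hτ.2.2.2 (a :: v) (hwv.trans (List.suffix_cons a v))
      (by have := (hτ.2.1 u hu).2.1; simp only [List.length_cons]; omega) ha with
    h | ⟨u', hu', h⟩ | ⟨s, hs, -, hsuf, hsne⟩
  · exact ⟨_, h, List.suffix_rfl⟩
  · exact ⟨u', hu', h.1⟩
  · have hsv : s <:+ v := (List.suffix_cons_iff.1 hsuf).resolve_left hsne
    exact absurd ⟨hsv.trans hvu, fun h => hne
      (hvu.eq_of_length (le_antisymm hvu.length_le (h ▸ hsv.length_le)))⟩
      (hτ.2.2.1 s hs u hu)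

lemma prod_filter_le_V (hτ : τ ∈ Fdw x n d w) {v : List A} (hwv : w <:+ v)
    (hex : ∃ u ∈ τ, v <:+ u) :
    ∏ u ∈ τ with v <:+ u, exp (-f) * Pml x n d u ≤ V x n d f v := by
  induction hk : d - v.length using Nat.strong_induction_on generalizing v with
  | _ k ih =>
  by_cases hv : v ∈ τ
  · have hfilter : τ.filter (fun u => v <:+ u) = {v} := by
      ext u
      simp only [Finset.mem_filter, Finset.mem_singleton]
      refine ⟨fun ⟨hu, hvu⟩ => ?_, ?_⟩
      · by_contra hne
        exact hτ.2.2.1 v hv u hu ⟨hvu, fun h => hne h.symm⟩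
      · rintro rfl
        exact ⟨hv, List.suffix_rfl⟩
    rw [hfilter, Finset.prod_singleton, V]
    split_ifs
    · exact le_max_left _ _
    · exact le_rfl
  · have hlt : v.length < d := by
      obtain ⟨u, hu, hvu⟩ := hex
      refine (lt_of_le_of_ne hvu.length_le fun h => ?_).trans_le (hτ.2.1 u hu).2.1
      exact hv (hvu.eq_of_length h ▸ hu)
    rw [V, dif_pos hlt]
    refine le_max_of_le_right (prod_filter_le_prod_children hτ hv fun a ha => ?_)
    exact ih (d - (a :: v).length) (by simp only [List.length_cons]; omega)
      (hwv.trans (List.suffix_cons a v)) (exists_cons_suffix_mem hτ hwv hv hex ha) rfl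

/-- If the context tree maximizing procedure does not branch at `w`, no competing tree
rooted at `w` has a larger penalized log-likelihood. -/
lemma sum_log_Pml_le_of_chi_eq_zero (hτ : τ ∈ Fdw x n d w) (hw : ∀ u ∈ τ, PSuffix w u)
    (hchi : chi x n d f w = 0) :
    ∑ u ∈ τ, (-f + log (Pml x n d u)) ≤ -f + log (Pml x n d w) := by
  obtain ⟨u₀, hu₀⟩ := hτ.1
  obtain ⟨hwu, hne⟩ := hw u₀ hu₀
  obtain ⟨-, hlen, hN⟩ := hτ.2.1 u₀ hu₀
  have hwτ : w ∉ τ := fun h => (hw w h).2 rfl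
  have hlt : w.length < d :=
    (lt_of_le_of_ne hwu.length_le fun h => hne (hwu.eq_of_length h)).trans_le hlen
  have hle : ∏ a : A, (if 1 ≤ Nw x n d (a :: w) then V x n d f (a :: w) else 1) ≤
      exp (-f) * Pml x n d w := by
    by_contra! h
    rw [chi, if_pos ⟨hN.trans (Nw_le_of_suffix hwu hlen), hlt, h⟩] at hchi
    exact one_ne_zero hchi
  have hprod := (prod_filter_le_prod_children (f := f) hτ hwτ fun a ha =>
    prod_filter_le_V hτ (List.suffix_cons a w)
      (exists_cons_suffix_mem hτ List.suffix_rfl hwτ ⟨u₀, hu₀, hwu⟩ ha)).trans hle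
  rw [Finset.filter_true_of_mem fun u hu => (hw u hu).1] at hprod
  have hpos : ∀ u, 0 < exp (-f) * Pml x n d u := fun u => mul_pos (exp_pos _) (Pml_pos u)
  have hlog : ∀ u, log (exp (-f) * Pml x n d u) = -f + log (Pml x n d u) := fun u => by
    rw [log_mul (exp_pos _).ne' (Pml_pos u).ne', log_exp]
  have := log_le_log (Finset.prod_pos fun u _ => hpos u) hprod
  rw [log_prod fun u _ => (hpos u).ne'] at this
  simpa only [hlog] using this

end Tree

lemma pow_length_le {B : Type*} {p : List B → ℝ} {α : ℝ} (hα : 0 < α) (hnil : p [] = 1)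
    (hlow : ∀ (u : List B) (a : B), α ≤ p (u ++ [a]) / p u) (u : List B) :
    α ^ u.length ≤ p u := by
  induction u using List.reverseRecOn with
  | nil => simp [hnil]
  | append_singleton u a ih =>
    have hpu : 0 < p u := (pow_pos hα _).trans_le ih
    rw [List.length_append, List.length_singleton, pow_succ']
    exact (mul_le_mul_of_nonneg_left ih hα.le).trans ((le_div_iff₀ hpu).1 (hlow u a))

/-- If all the counts at `w` and at the leaves of `τ` are close to their means, the gain in
log-likelihood obtained by branching at `w` is close to its limiting value. -/
lemma log_likelihood_gain_ge {x : ℕ → A} {n d : ℕ} {w : List A} {τ : Finset (List A)}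
    {p : List A → ℝ} {α M ε β : ℝ} (hM : 0 < M) (hε : 0 < ε) (hε1 : ε ≤ 1) (hα : 0 < α)
    (hpos : ∀ u, 0 < p u) (hsum : ∀ u, p u = ∑ b : A, p (u ++ [b]))
    (hlow : ∀ (u : List A) (a : A), α ≤ p (u ++ [a]) / p u)
    (hβ : ∀ a, (p (w ++ [a]))⁻¹ ≤ β)
    (hclose : ∀ u ∈ insert w τ, ∀ a, |(Nwa x n d u a : ℝ) - M * p (u ++ [a])| ≤ M * ε) :
    M * (∑ a : A, ((∑ u ∈ τ, p (u ++ [a]) * log (p (u ++ [a]) / p u)) -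
          p (w ++ [a]) * log (p (w ++ [a]) / p w)) -
        ε * (Fintype.card A * ((τ.card + 1) * -log α + β))) ≤
      ∑ u ∈ τ, log (Pml x n d u) - log (Pml x n d w) := by
  have hlogabs : ∀ (u : List A) a, |log (p (u ++ [a]) / p u)| ≤ -log α := by
    intro u a
    have hle : p (u ++ [a]) / p u ≤ 1 := by
      rw [div_le_one (hpos u), hsum u]
      exact Finset.single_le_sum (f := fun b => p (u ++ [b])) (fun b _ => (hpos _).le)
        (Finset.mem_univ a)
    rw [abs_of_nonpos (log_nonpos (hα.le.trans (hlow u a)) hle)]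
    exact neg_le_neg (log_le_log hα (hlow u a))
  have hdev : ∀ u ∈ insert w τ, ∀ a,
      |(Nwa x n d u a : ℝ) * log (p (u ++ [a]) / p u) -
        M * (p (u ++ [a]) * log (p (u ++ [a]) / p u))| ≤ M * ε * -log α := by
    intro u hu a
    rw [← mul_assoc, ← sub_mul, abs_mul]
    exact mul_le_mul (hclose u hu a) (hlogabs u a) (abs_nonneg _) (by positivity)
  have hleaf : ∀ u ∈ τ, ∑ a, (M * (p (u ++ [a]) * log (p (u ++ [a]) / p u)) -
      M * ε * -log α) ≤ log (Pml x n d u) := by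
    intro u hu
    rw [log_Pml]
    refine le_trans (Finset.sum_le_sum fun a _ => ?_) (gibbs_inequality
      (fun a => (Nwa x n d u a : ℝ)) (fun a => p (u ++ [a])) (fun a => Nat.cast_nonneg _)
      fun a => hpos _)
    rw [← hsum u]
    linarith [(abs_le.1 (hdev u (Finset.mem_insert_of_mem hu) a)).1]
  have hroot : log (Pml x n d w) ≤ ∑ a, (M * (p (w ++ [a]) * log (p (w ++ [a]) / p w)) +
      M * ε * -log α + M * ε * β) := by
    rw [log_Pml]
    refine (sum_mul_log_le_add_chi_square (fun a => (Nwa x n d w a : ℝ))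
      (fun a => M * p (w ++ [a])) (fun a => Nat.cast_nonneg _)
      fun a => mul_pos hM (hpos _)).trans ?_
    rw [← Finset.sum_add_distrib, ← Finset.mul_sum, ← hsum w]
    refine Finset.sum_le_sum fun a _ => ?_
    have h1 := (abs_le.1 (hdev w (Finset.mem_insert_self _ _) a)).2
    have h2 : ((Nwa x n d w a : ℝ) - M * p (w ++ [a])) ^ 2 / (M * p (w ++ [a])) ≤
        M * ε * β := by
      have hsq : ((Nwa x n d w a : ℝ) - M * p (w ++ [a])) ^ 2 ≤ (M * ε) ^ 2 :=
        sq_le_sq' (abs_le.1 (hclose w (Finset.mem_insert_self _ _) a)).1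
          (abs_le.1 (hclose w (Finset.mem_insert_self _ _) a)).2
      have hp := hpos (w ++ [a])
      calc _ ≤ (M * ε) ^ 2 / (M * p (w ++ [a])) := by gcongr
        _ = M * (ε * ε) * (p (w ++ [a]))⁻¹ := by field_simp
        _ ≤ M * (ε * 1) * β := by gcongr; exact hβ a
        _ = M * ε * β := by ring
    rw [mul_div_mul_left _ _ hM.ne']
    linarith
  have hleaves := Finset.sum_le_sum hleaf
  simp only [Finset.sum_sub_distrib, Finset.sum_add_distrib, Finset.sum_const,
    Finset.card_univ, nsmul_eq_mul, ← Finset.mul_sum] at hleaves hroot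
  rw [Finset.sum_sub_distrib, Finset.sum_comm]
  linarith

/-- **Underestimation bound at a single interior node (Theorem, part (a)).**  Under
the concentration hypothesis with constant `C > 0`, suppose `p(a|u) ≥ α₀` for every
string `u` and every `a ∈ A` (with `0 < α₀ < 1`).  Given a prescribed cardinality
`m`, height `hgt` and divergence `δ > 0`, there exist constants `c₁ > 0` and
`c₂ > 0`, depending only on `|A|`, `C`, `α₀`, `δ`, `m = |τ'|` and `hgt = h(τ')`,
such that for every finite set `τ'` of strings with `|τ'| = m`, `h(τ') = hgt`,
whose elements are proper extensions of `w` of length at most `d`, which is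
suffix-free, satisfies `p(wa) = ∑_{u∈τ'} p(ua)` for every `a ∈ A` and
`δ = ∑ₐ [ ∑_{u∈τ'} p(ua) log p(a|u) − p(wa) log p(a|w) ]`, and for every
penalizing value `f(n) > 0` with `|τ'| f(n)/(n−d) < δ/2`,
`P({τ' ∈ F^d_w(X₁ⁿ)} ∩ {χ_w(X₁ⁿ) = 0}) ≤ c₁ exp(−c₂ (n−d))`. -/
theorem underestimation_bound {A : Type} [Fintype A] [DecidableEq A]
    [MeasurableSpace A] (hA : 1 < Fintype.card A)
    (C : ℝ) (hC : 0 < C) (α₀ : ℝ) (hα0 : 0 < α₀) (hα1 : α₀ < 1)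
    (m hgt : ℕ) (δ : ℝ) (hδ : 0 < δ) :
    ∃ c₁ c₂ : ℝ, 0 < c₁ ∧ 0 < c₂ ∧
      ∀ (Ω : Type) [MeasurableSpace Ω] (P : Measure Ω) [IsProbabilityMeasure P]
        (n d : ℕ), 0 < d → d < n →
        ∀ (X : ℕ → Ω → A), (∀ t, Measurable (X t)) →
        ∀ (p : List A → ℝ), (∀ u, 0 ≤ p u ∧ p u ≤ 1) → p ([] : List A) = 1 →
        (∀ u, p u = ∑ b : A, p (u ++ [b])) →
        (∀ (u : List A) (a : A), α₀ ≤ p (u ++ [a]) / p u) →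
        (∀ u : List A, u.length ≤ d → ∀ a : A, ∀ t : ℝ, 0 < t →
          P {ω | t < |(Nwa (fun s => X s ω) n d u a : ℝ) -
              ((n : ℝ) - d) * p (u ++ [a])|} ≤
            ENNReal.ofReal (Real.exp (1 / Real.exp 1) *
              Real.exp (-(t ^ 2 * C / (((n : ℝ) - d) * (u.length + 1)))))) →
        ∀ (w : List A) (τ' : Finset (List A)),
        τ'.card = m → τ'.sup List.length = hgt →
        (∀ u ∈ τ', PSuffix w u ∧ u.length ≤ d) →
        (∀ u ∈ τ', ∀ v ∈ τ', ¬ PSuffix u v) →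
        (∀ a : A, p (w ++ [a]) = ∑ u ∈ τ', p (u ++ [a])) →
        δ = ∑ a : A, ((∑ u ∈ τ', p (u ++ [a]) * Real.log (p (u ++ [a]) / p u)) -
          p (w ++ [a]) * Real.log (p (w ++ [a]) / p w)) →
        ∀ f : ℝ, 0 < f → (τ'.card : ℝ) * f / ((n : ℝ) - d) < δ / 2 →
        P {ω | τ' ∈ Fdw (fun s => X s ω) n d w ∧
            chi (fun s => X s ω) n d f w = 0} ≤
          ENNReal.ofReal (c₁ * Real.exp (-(c₂ * ((n : ℝ) - d)))) := by
  set β : ℝ := (α₀ ^ (hgt + 1))⁻¹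
  have hβ0 : 0 < β := by positivity
  have hlogα : 0 < -log α₀ := neg_pos.2 (log_neg hα0 hα1)
  have hcard : (0 : ℝ) < Fintype.card A := by exact_mod_cast (zero_lt_one.trans hA)
  set K : ℝ := Fintype.card A * ((m + 1) * -log α₀ + β) with hK
  have hK0 : 0 < K := by positivity
  set ε : ℝ := min 1 (δ / 2 / K)
  have hε : 0 < ε := lt_min one_pos (by positivity)
  have hε1 : ε ≤ 1 := min_le_left _ _
  have hεK : ε * K ≤ δ / 2 := (le_div_iff₀ hK0).1 (min_le_right _ _)
  refine ⟨(m + 1) * (Fintype.card A * exp (1 / exp 1)), ε ^ 2 * C / (hgt + 1),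
    by positivity, by positivity, ?_⟩
  intro Ω _ P _ n d _ hdn X _ p _ hnil hsum hlow hconc w τ hm hh hτ _ _ hδeq f _ hf
  have hM : (0 : ℝ) < (n : ℝ) - d := sub_pos.2 (by exact_mod_cast hdn)
  have hpow := pow_length_le hα0 hnil hlow
  have hpos : ∀ u, 0 < p u := fun u => (pow_pos hα0 _).trans_le (hpow u)
  rcases τ.eq_empty_or_nonempty with rfl | ⟨u₀, hu₀⟩
  · simp [Fdw]
  have hlen : ∀ u ∈ insert w τ, u.length ≤ d ∧ u.length ≤ hgt := by
    have hmem : ∀ u ∈ τ, u.length ≤ d ∧ u.length ≤ hgt := fun u hu =>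
      ⟨(hτ u hu).2, hh ▸ Finset.le_sup (f := List.length) hu⟩
    intro u hu
    rcases Finset.mem_insert.1 hu with rfl | hu
    · have := (hτ u₀ hu₀).1.1.length_le
      have := hmem u₀ hu₀
      omega
    · exact hmem u hu
  have hβ : ∀ a, (p (w ++ [a]))⁻¹ ≤ β := fun a => by
    refine inv_anti₀ (by positivity) (le_trans ?_ (hpow _))
    refine pow_le_pow_of_le_one hα0.le hα1.le ?_
    simpa using (hlen w (Finset.mem_insert_self _ _)).2
  have hsub : {ω | τ ∈ Fdw (fun s => X s ω) n d w ∧ chi (fun s => X s ω) n d f w = 0} ⊆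
      ⋃ u ∈ insert w τ, ⋃ a ∈ (Finset.univ : Finset A),
        {ω | ((n : ℝ) - d) * ε < |(Nwa (fun s => X s ω) n d u a : ℝ) -
          ((n : ℝ) - d) * p (u ++ [a])|} := by
    rintro ω ⟨hF, hchi⟩
    by_contra hnot
    simp only [Set.mem_iUnion, Set.mem_ofPred_eq, not_exists, not_lt] at hnot
    have hgain := log_likelihood_gain_ge hM hε hε1 hα0 hpos hsum hlow hβ
      fun u hu a => hnot u hu a (Finset.mem_univ a)
    rw [← hδeq, hm, ← hK] at hgain
    have hup := sum_log_Pml_le_of_chi_eq_zero hF (fun u hu => (hτ u hu).1) hchi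
    rw [Finset.sum_add_distrib, Finset.sum_const, nsmul_eq_mul] at hup
    rw [div_lt_iff₀ hM] at hf
    have := mul_le_mul_of_nonneg_left hεK hM.le
    nlinarith
  have hbound : ∀ u ∈ insert w τ, ∀ a,
      P {ω | ((n : ℝ) - d) * ε < |(Nwa (fun s => X s ω) n d u a : ℝ) -
          ((n : ℝ) - d) * p (u ++ [a])|} ≤
        ENNReal.ofReal (exp (1 / exp 1) *
          exp (-(ε ^ 2 * C / (hgt + 1) * ((n : ℝ) - d)))) := by
    intro u hu a
    refine (hconc u (hlen u hu).1 a _ (by positivity)).trans (ENNReal.ofReal_le_ofReal ?_)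
    gcongr
    have hle : (u.length : ℝ) ≤ hgt := by exact_mod_cast (hlen u hu).2
    calc ε ^ 2 * C / (hgt + 1) * ((n : ℝ) - d)
        ≤ ε ^ 2 * C / (u.length + 1) * ((n : ℝ) - d) := by gcongr
      _ = (((n : ℝ) - d) * ε) ^ 2 * C / (((n : ℝ) - d) * (u.length + 1)) := by field_simp
  obtain ⟨E, hE⟩ : ∃ E, E = exp (1 / exp 1) * exp (-(ε ^ 2 * C / (hgt + 1) * ((n : ℝ) - d))) :=
    ⟨_, rfl⟩
  rw [← hE] at hbound
  have hE0 : 0 < E := hE ▸ mul_pos (exp_pos _) (exp_pos _)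
  calc _ ≤ ∑ u ∈ insert w τ, ∑ _a : A, ENNReal.ofReal E := by
        refine (measure_mono hsub).trans ((measure_biUnion_finset_le _ _).trans
          (Finset.sum_le_sum fun u hu => ?_))
        exact (measure_biUnion_finset_le _ _).trans
          (Finset.sum_le_sum fun a _ => hbound u hu a)
    _ = ENNReal.ofReal ((insert w τ).card * (Fintype.card A * E)) := by
        rw [ENNReal.ofReal_mul (Nat.cast_nonneg _), ENNReal.ofReal_mul hcard.le]
        simp only [Finset.sum_const, nsmul_eq_mul, Finset.card_univ, ENNReal.ofReal_natCast]
    _ ≤ _ := by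
        refine ENNReal.ofReal_le_ofReal ?_
        have hins : ((insert w τ).card : ℝ) ≤ m + 1 := by
          exact_mod_cast hm ▸ Finset.card_insert_le w τ
        calc ((insert w τ).card : ℝ) * (Fintype.card A * E)
            ≤ (m + 1) * (Fintype.card A * E) := by gcongr
          _ = _ := by rw [hE]; ring
end
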